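/- Assume (H) and let g : ℝ^d → ℂ be a nonzero Schwartz function. Let 1 ≤ p ≤ ∞ with Hölder conjugate p', let 1 ≤ q ≤ p', and define r ∈ [1,∞] by 1/r = 1/p + 1/q − 1. Then there exists a constant C > 0 such that for every t ∈ (0,1] and every Schwartz function h : ℝ^d → ℂ, sup_{ξ∈ℝ^d} ( ∫_{ℝ^d} |V_g(F_{tμ}·h)(x,ξ)|^q dx )^{1/q} ≤ C · t^{-2d/(mp')} · ∫_{ℝ^d} ( ∫_{ℝ^d} |V_g h(x,ξ)|^r dx )^{1/r} dξ, with the usual essential-supremum modification of the inner norms when q = ∞ or r = ∞. (This is the smoothing estimate ‖e^{2πitμ(D)} f‖_{W^{q,∞}} ≲ t^{-2d/(mp')} ‖f‖_{W^{r,1}} for 0 < t ≤ 1, written on the Fourier-transform side.) -/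

import Mathlib

open MeasureTheory Real Complex
open scoped ENNReal RealInnerProductSpace

noncomputable section

set_option linter.unusedSectionVars false

namespace SmoothEst

/-- `BddC U e n f`: the family `f i` has uniformly bounded iterated derivatives in the direction
`e i` up to order `n` on the sets `U i`. -/
def BddC {ι : Type} {E : Type} [NormedAddCommGroup E] [NormedSpace ℝ E]
    (U : ι → Set E) (e : ι → E) : ℕ → (ι → E → ℂ) → Prop
  | 0, f => ∃ C : ℝ, ∀ i, ∀ y ∈ U i, ‖f i y‖ ≤ C
  | n + 1, f => (∃ C : ℝ, ∀ i, ∀ y ∈ U i, ‖f i y‖ ≤ C) ∧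
      (∀ i, ∀ y ∈ U i, DifferentiableAt ℝ (f i) y) ∧
      BddC U e n (fun i y => fderiv ℝ (f i) y (e i))

section bdd
variable {ι : Type} {E : Type} [NormedAddCommGroup E] [NormedSpace ℝ E]
  {U : ι → Set E} {e : ι → E}

lemma BddC.bound {n : ℕ} {f : ι → E → ℂ} (h : BddC U e n f) :
    ∃ C : ℝ, ∀ i, ∀ y ∈ U i, ‖f i y‖ ≤ C := by
  cases n with
  | zero => exact h
  | succ n => exact h.1

lemma BddC.pred {n : ℕ} : ∀ {f : ι → E → ℂ}, BddC U e (n + 1) f → BddC U e n f := by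
  induction n with
  | zero => intro f h; exact h.1
  | succ n ih => intro f h; exact ⟨h.1, h.2.1, ih h.2.2⟩

lemma BddC.congr (hU : ∀ i, IsOpen (U i)) {n : ℕ} : ∀ {f g : ι → E → ℂ},
    (∀ i, ∀ y ∈ U i, f i y = g i y) → BddC U e n f → BddC U e n g := by
  induction n with
  | zero =>
    rintro f g hfg ⟨C, hC⟩
    exact ⟨C, fun i y hy => by rw [← hfg i y hy]; exact hC i y hy⟩
  | succ n ih =>
    rintro f g hfg ⟨⟨C, hC⟩, hd, hb⟩
    have hev : ∀ i, ∀ y ∈ U i, f i =ᶠ[nhds y] g i := fun i y hy =>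
      Filter.eventuallyEq_of_mem ((hU i).mem_nhds hy) (hfg i)
    refine ⟨⟨C, fun i y hy => by rw [← hfg i y hy]; exact hC i y hy⟩, ?_, ?_⟩
    · intro i y hy
      exact ((hev i y hy).differentiableAt_iff).1 (hd i y hy)
    · refine ih ?_ hb
      intro i y hy
      rw [(hev i y hy).fderiv_eq]

lemma BddC.add (hU : ∀ i, IsOpen (U i)) {n : ℕ} : ∀ {f g : ι → E → ℂ},
    BddC U e n f → BddC U e n g → BddC U e n (fun i y => f i y + g i y) := by
  induction n with
  | zero =>
    rintro f g ⟨C, hC⟩ ⟨C', hC'⟩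
    exact ⟨C + C', fun i y hy => (norm_add_le _ _).trans (add_le_add (hC i y hy) (hC' i y hy))⟩
  | succ n ih =>
    rintro f g ⟨⟨C, hC⟩, hd, hb⟩ ⟨⟨C', hC'⟩, hd', hb'⟩
    refine ⟨⟨C + C', fun i y hy => (norm_add_le _ _).trans
      (add_le_add (hC i y hy) (hC' i y hy))⟩, fun i y hy => (hd i y hy).add (hd' i y hy), ?_⟩
    refine BddC.congr hU ?_ (ih hb hb')
    intro i y hy
    rw [fderiv_fun_add (hd i y hy) (hd' i y hy)]
    rfl

lemma BddC.mul (hU : ∀ i, IsOpen (U i)) {n : ℕ} : ∀ {f g : ι → E → ℂ},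
    BddC U e n f → BddC U e n g → BddC U e n (fun i y => f i y * g i y) := by
  have key : ∀ {f g : ι → E → ℂ}, (∃ C : ℝ, ∀ i, ∀ y ∈ U i, ‖f i y‖ ≤ C) →
      (∃ C : ℝ, ∀ i, ∀ y ∈ U i, ‖g i y‖ ≤ C) →
      (∃ C : ℝ, ∀ i, ∀ y ∈ U i, ‖f i y * g i y‖ ≤ C) := by
    rintro f g ⟨C, hC⟩ ⟨C', hC'⟩
    refine ⟨C * C', fun i y hy => ?_⟩
    rw [norm_mul]
    exact mul_le_mul (hC i y hy) (hC' i y hy) (norm_nonneg _) ((norm_nonneg _).trans (hC i y hy))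
  induction n with
  | zero => exact fun hf hg => key hf hg
  | succ n ih =>
    intro f g hf hg
    refine ⟨key hf.1 hg.1, fun i y hy => (hf.2.1 i y hy).mul (hg.2.1 i y hy), ?_⟩
    refine BddC.congr hU ?_ (BddC.add hU (ih hf.pred hg.2.2) (ih hg.pred hf.2.2))
    intro i y hy
    rw [fderiv_fun_mul (hf.2.1 i y hy) (hg.2.1 i y hy)]
    rfl

lemma BddC.const (c : ℂ) {n : ℕ} : BddC U e n (fun _ _ => c) := by
  induction n generalizing c with
  | zero => exact ⟨‖c‖, fun _ _ _ => le_rfl⟩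
  | succ n ih =>
    refine ⟨⟨‖c‖, fun _ _ _ => le_rfl⟩, fun _ _ _ => differentiableAt_const _, ?_⟩
    have := ih 0
    simpa using this

lemma BddC.inv (hU : ∀ i, IsOpen (U i)) {n : ℕ} {f : ι → E → ℂ} {c : ℝ} (hc : 0 < c)
    (hf : BddC U e n f) (hl : ∀ i, ∀ y ∈ U i, c ≤ ‖f i y‖) :
    BddC U e n (fun i y => (f i y)⁻¹) := by
  have key : (∃ C : ℝ, ∀ i, ∀ y ∈ U i, ‖(f i y)⁻¹‖ ≤ C) := by
    refine ⟨c⁻¹, fun i y hy => ?_⟩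
    rw [norm_inv]
    exact inv_anti₀ hc (hl i y hy)
  have h0 : ∀ i, ∀ y ∈ U i, f i y ≠ 0 := fun i y hy h => by
    have := hl i y hy
    rw [h, norm_zero] at this
    linarith
  induction n with
  | zero => exact key
  | succ n ih =>
    have hi := ih hf.pred
    refine ⟨key, fun i y hy => (hf.2.1 i y hy).inv (h0 i y hy), ?_⟩
    refine BddC.congr hU ?_
      (BddC.mul hU (BddC.mul hU (BddC.const (-1)) hf.2.2) (BddC.mul hU hi hi))
    intro i y hy
    have h1 : HasFDerivAt (fun y => (f i y)⁻¹) (-((f i y)^2)⁻¹ • fderiv ℝ (f i) y) y := by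
      have := (hasDerivAt_inv (h0 i y hy)).comp_hasFDerivAt_of_eq y
        (hf.2.1 i y hy).hasFDerivAt rfl
      exact this
    rw [h1.fderiv]
    simp
    ring

/-- Families obtained by applying functionals to a fixed function, Schwartz version. -/
lemma BddC.schwartz (N : ℕ) (he : ∀ i, ‖e i‖ ≤ 1) (z x : ι → E)
    (hUz : ∀ i, ∀ y ∈ U i, ‖y - z i‖ ≤ 1) {n : ℕ} :
    ∀ {F : Type} [NormedAddCommGroup F] [NormedSpace ℝ F] (g : SchwartzMap E F)
      (L : ι → F →L[ℝ] ℂ) (_ : ∀ i, ‖L i‖ ≤ (1 + ‖z i - x i‖) ^ N),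
      BddC U e n (fun i y => L i (g (y - x i))) := by
  have key : ∀ {F : Type} [NormedAddCommGroup F] [NormedSpace ℝ F] (g : SchwartzMap E F)
      (L : ι → F →L[ℝ] ℂ) (_ : ∀ i, ‖L i‖ ≤ (1 + ‖z i - x i‖) ^ N),
      ∃ C : ℝ, ∀ i, ∀ y ∈ U i, ‖L i (g (y - x i))‖ ≤ C := by
    intro F _ _ g L hL
    have hdec := g.one_add_le_sup_seminorm_apply (𝕜 := ℝ) (m := (N, 0)) (k := N) (n := 0) le_rfl le_rfl
    refine ⟨2 ^ N * (2 ^ N * ((Finset.Iic (N, 0)).sup fun m => SchwartzMap.seminorm ℝ m.1 m.2) g),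
      fun i y hy => ?_⟩
    have h1 := hdec (y - x i)
    rw [norm_iteratedFDeriv_zero] at h1
    have h2 : 1 + ‖z i - x i‖ ≤ 2 * (1 + ‖y - x i‖) := by
      have := norm_sub_le (y - x i) (y - z i)
      have h3 := hUz i y hy
      have h4 : y - x i - (y - z i) = z i - x i := by abel
      rw [h4] at this
      have := norm_nonneg (y - x i)
      linarith
    calc ‖L i (g (y - x i))‖ ≤ ‖L i‖ * ‖g (y - x i)‖ := (L i).le_opNorm _
      _ ≤ (2 * (1 + ‖y - x i‖)) ^ N * ‖g (y - x i)‖ := by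
        gcongr
        exact (hL i).trans (by gcongr)
      _ = 2 ^ N * ((1 + ‖y - x i‖) ^ N * ‖g (y - x i)‖) := by rw [mul_pow]; ring
      _ ≤ _ := by gcongr
  induction n with
  | zero => intro F _ _ g L hL; exact key g L hL
  | succ n ih =>
    intro F _ _ g L hL
    have hd : ∀ i y, HasFDerivAt (fun y => L i (g (y - x i)))
        ((L i).comp (fderiv ℝ g (y - x i))) y := by
      intro i y
      have h1 : HasFDerivAt (fun y => y - x i) (ContinuousLinearMap.id ℝ E) y :=
        (hasFDerivAt_id y).sub_const _
      have h2 := (L i).hasFDerivAt.comp y ((g.hasFDerivAt (y - x i)).comp y h1)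
      rw [ContinuousLinearMap.comp_id] at h2
      exact h2
    refine ⟨key g L hL, fun i y _ => (hd i y).differentiableAt, ?_⟩
    have h3 := ih (SchwartzMap.fderivCLM ℝ E F g)
      (fun i => (L i).comp (ContinuousLinearMap.apply ℝ F (e i))) (by
        intro i
        refine le_trans ?_ (hL i)
        refine ContinuousLinearMap.opNorm_le_bound _ (norm_nonneg _) fun T => ?_
        simp only [ContinuousLinearMap.comp_apply, ContinuousLinearMap.apply_apply]
        refine ((L i).le_opNorm _).trans ?_
        gcongr
        refine (T.le_opNorm _).trans ?_
        exact mul_le_of_le_one_right (norm_nonneg _) (he i))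
    have h4 : (fun i y => (fderiv ℝ (fun y => L i (g (y - x i))) y) (e i)) =
        (fun i y => ((L i).comp (ContinuousLinearMap.apply ℝ F (e i)))
          ((SchwartzMap.fderivCLM ℝ E F g) (y - x i))) := by
      funext i y
      rw [(hd i y).fderiv]
      rfl
    exact h4 ▸ h3

end bdd
end SmoothEst

namespace SmoothEst
/-- Positive homogeneity of degree `s` away from the origin. -/
def Hom {E F : Type} [NormedAddCommGroup E] [NormedSpace ℝ E]
    [NormedAddCommGroup F] [NormedSpace ℝ F] (s : ℝ) (f : E → F) : Prop :=
  ∀ c : ℝ, 0 < c → ∀ x : E, x ≠ 0 → f (c • x) = c ^ s • f x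

/-- Smoothness away from the origin. -/
def Smo {E F : Type} [NormedAddCommGroup E] [NormedSpace ℝ E]
    [NormedAddCommGroup F] [NormedSpace ℝ F] (f : E → F) : Prop :=
  ContDiffOn ℝ (⊤ : ℕ∞) f {x | x ≠ 0}

section hom
variable {E F : Type} [NormedAddCommGroup E] [NormedSpace ℝ E]
    [NormedAddCommGroup F] [NormedSpace ℝ F]

lemma isOpen_ne0 : IsOpen {x : E | x ≠ 0} := isOpen_ne

lemma Smo.contDiffAt {f : E → F} (hf : Smo f) {x : E} (hx : x ≠ 0) :
    ContDiffAt ℝ (⊤ : ℕ∞) f x := ContDiffOn.contDiffAt hf (isOpen_ne0.mem_nhds hx)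

lemma Smo.diff {f : E → F} (hf : Smo f) {x : E} (hx : x ≠ 0) : DifferentiableAt ℝ f x :=
  (hf.contDiffAt hx).differentiableAt (by simp)

lemma Smo.fderiv {f : E → F} (hf : Smo f) : Smo (fderiv ℝ f) :=
  ContDiffOn.fderiv_of_isOpen hf isOpen_ne0 (by simp)

lemma Hom.fderiv {f : E → F} {s : ℝ} (hs : Smo f) (hf : Hom s f) : Hom (s - 1) (fderiv ℝ f) := by
  intro c hc x hx
  have hcx : c • x ≠ 0 := smul_ne_zero hc.ne' hx
  have h1 : HasFDerivAt (fun y => f (c • y)) (c • _root_.fderiv ℝ f (c • x)) x := by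
    have h2 : HasFDerivAt (fun y : E => c • y) (c • ContinuousLinearMap.id ℝ E) x :=
      (hasFDerivAt_id x).const_smul c
    have h3 := (hs.diff hcx).hasFDerivAt.comp x h2
    have h4 : (_root_.fderiv ℝ f (c • x)).comp (c • ContinuousLinearMap.id ℝ E) =
      c • _root_.fderiv ℝ f (c • x) := by
      ext v; simp
    rw [h4] at h3
    exact h3
  have h5 : HasFDerivAt (fun y => c ^ s • f y) (c ^ s • _root_.fderiv ℝ f x) x :=
    (hs.diff hx).hasFDerivAt.const_smul _
  have h6 : (fun y => f (c • y)) =ᶠ[nhds x] (fun y => c ^ s • f y) :=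
    Filter.eventuallyEq_of_mem (isOpen_ne0.mem_nhds hx) (fun y hy => hf c hc y hy)
  have h7 := h1.unique (h5.congr_of_eventuallyEq h6)
  have h8 : c⁻¹ • (c • _root_.fderiv ℝ f (c • x)) = _root_.fderiv ℝ f (c • x) := by
    rw [smul_smul, inv_mul_cancel₀ hc.ne', one_smul]
  rw [← h8, h7, smul_smul, Real.rpow_sub hc, Real.rpow_one]
  congr 1
  ring

lemma Hom.bound [FiniteDimensional ℝ E] {f : E → F} {s : ℝ} (hs : Smo f) (hf : Hom s f) :
    ∃ C : ℝ, 0 ≤ C ∧ ∀ x ≠ 0, ‖f x‖ ≤ C * ‖x‖ ^ s := by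
  have hc : IsCompact (Metric.sphere (0 : E) 1) := isCompact_sphere 0 1
  have hcont : ContinuousOn f (Metric.sphere (0 : E) 1) := fun x hx =>
    (hs.contDiffAt (by
      intro h; rw [h] at hx; simp at hx)).continuousAt.continuousWithinAt
  obtain ⟨C, hC⟩ := hc.exists_bound_of_continuousOn hcont
  refine ⟨max C 0, le_max_right _ _, fun x hx => ?_⟩
  have hx' : 0 < ‖x‖ := norm_pos_iff.2 hx
  have hu : ‖‖x‖⁻¹ • x‖ = 1 := by
    rw [norm_smul, norm_inv, norm_norm, inv_mul_cancel₀ hx'.ne']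
  have hu0 : ‖x‖⁻¹ • x ≠ 0 := fun h => by rw [h] at hu; simp at hu
  have h1 := hf ‖x‖ hx' (‖x‖⁻¹ • x) hu0
  rw [smul_smul, mul_inv_cancel₀ hx'.ne', one_smul] at h1
  rw [h1, norm_smul, mul_comm, Real.norm_of_nonneg (by positivity)]
  gcongr
  exact (hC _ (by simpa using hu)).trans (le_max_left _ _)

lemma Hom.euler {f : E → F} {s : ℝ} (hs : Smo f) (hf : Hom s f) {x : E} (hx : x ≠ 0) :
    _root_.fderiv ℝ f x x = s • f x := by
  have h1 : HasDerivAt (fun c : ℝ => f (c • x)) (_root_.fderiv ℝ f x x) 1 := by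
    have h2 : HasDerivAt (fun c : ℝ => c • x) x 1 := by
      simpa using (hasDerivAt_id (1 : ℝ)).smul_const x
    have h3 : HasFDerivAt f (_root_.fderiv ℝ f x) ((1 : ℝ) • x) := by
      rw [one_smul]; exact (hs.diff hx).hasFDerivAt
    exact h3.comp_hasDerivAt 1 h2
  have h4 : HasDerivAt (fun c : ℝ => c ^ s • f x) (s • f x) 1 := by
    have := (Real.hasDerivAt_rpow_const (x := 1) (p := s) (Or.inl one_ne_zero)).smul_const (f x)
    simpa using this
  refine h1.unique (h4.congr_of_eventuallyEq ?_)
  filter_upwards [lt_mem_nhds (zero_lt_one' ℝ)] with c hc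
  exact hf c hc x hx

lemma BddC.hom [FiniteDimensional ℝ E] {ι : Type} {U : ι → Set E} {e : ι → E}
    (hU : ∀ i, IsOpen (U i)) (he : ∀ i, ‖e i‖ ≤ 1)
    (hU1 : ∀ i, ∀ y ∈ U i, 1 ≤ ‖y‖) (B : ℝ) {n : ℕ} :
    ∀ {F : Type} [NormedAddCommGroup F] [NormedSpace ℝ F] {s : ℝ} {f : E → F}
      (_ : Smo f) (_ : Hom s f)
      (L : ι → F →L[ℝ] ℂ) (_ : ∀ i, ∀ y ∈ U i, ‖L i‖ * ‖y‖ ^ s ≤ B),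
      BddC U e n (fun i y => L i (f y)) := by
  have key : ∀ {F : Type} [NormedAddCommGroup F] [NormedSpace ℝ F] {s : ℝ} {f : E → F}
      (_ : Smo f) (_ : Hom s f)
      (L : ι → F →L[ℝ] ℂ) (_ : ∀ i, ∀ y ∈ U i, ‖L i‖ * ‖y‖ ^ s ≤ B),
      ∃ C : ℝ, ∀ i, ∀ y ∈ U i, ‖L i (f y)‖ ≤ C := by
    intro F _ _ s f hs hf L hL
    obtain ⟨C, hC0, hC⟩ := hf.bound hs
    refine ⟨C * B, fun i y hy => ?_⟩
    have hy0 : y ≠ 0 := fun h => by have := hU1 i y hy; rw [h] at this; norm_num at this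
    calc ‖L i (f y)‖ ≤ ‖L i‖ * ‖f y‖ := (L i).le_opNorm _
      _ ≤ ‖L i‖ * (C * ‖y‖ ^ s) := by gcongr; exact hC y hy0
      _ = C * (‖L i‖ * ‖y‖ ^ s) := by ring
      _ ≤ C * B := by gcongr; exact hL i y hy
  induction n with
  | zero => intro F _ _ s f hs hf L hL; exact key hs hf L hL
  | succ n ih =>
    intro F _ _ s f hs hf L hL
    have hd : ∀ i, ∀ y ∈ U i, HasFDerivAt (fun y => L i (f y))
        ((L i).comp (_root_.fderiv ℝ f y)) y := by
      intro i y hy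
      have hy0 : y ≠ 0 := fun h => by have := hU1 i y hy; rw [h] at this; norm_num at this
      exact (L i).hasFDerivAt.comp y (hs.diff hy0).hasFDerivAt
    refine ⟨key hs hf L hL, fun i y hy => (hd i y hy).differentiableAt, ?_⟩
    have h3 := ih hs.fderiv (hf.fderiv hs)
      (fun i => (L i).comp (ContinuousLinearMap.apply ℝ F (e i))) (by
        intro i y hy
        refine le_trans ?_ (hL i y hy)
        have h1 : ‖(L i).comp (ContinuousLinearMap.apply ℝ F (e i))‖ ≤ ‖L i‖ := by
          refine ContinuousLinearMap.opNorm_le_bound _ (norm_nonneg _) fun T => ?_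
          simp only [ContinuousLinearMap.comp_apply, ContinuousLinearMap.apply_apply]
          refine ((L i).le_opNorm _).trans ?_
          gcongr
          refine (T.le_opNorm _).trans ?_
          exact mul_le_of_le_one_right (norm_nonneg _) (he i)
        have h2 : ‖y‖ ^ (s - 1) ≤ ‖y‖ ^ s :=
          Real.rpow_le_rpow_of_exponent_le (hU1 i y hy) (by linarith)
        gcongr)
    refine BddC.congr hU ?_ h3
    intro i y hy
    rw [(hd i y hy).fderiv]
    rfl
end hom

section ibp
variable {E : Type} [NormedAddCommGroup E] [NormedSpace ℝ E] [FiniteDimensional ℝ E]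
  [MeasurableSpace E] [BorelSpace E] (ν : Measure E) [ν.IsAddHaarMeasure]

lemma contDiff_of_supp {G : E → ℂ} {U K : Set E} (hU : IsOpen U) (hK : IsClosed K) (hKU : K ⊆ U)
    (hG : ContDiffOn ℝ (⊤ : ℕ∞) G U) (h0 : ∀ y ∉ K, G y = 0) : ContDiff ℝ (⊤ : ℕ∞) G := by
  rw [contDiff_iff_contDiffAt]
  intro y
  by_cases hy : y ∈ U
  · exact hG.contDiffAt (hU.mem_nhds hy)
  · have h1 : G =ᶠ[nhds y] (fun _ => 0) :=
      Filter.eventuallyEq_of_mem (hK.isOpen_compl.mem_nhds (fun h => hy (hKU h))) h0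
    exact contDiffAt_const.congr_of_eventuallyEq h1

lemma fderiv_zero_of_supp {G : E → ℂ} {K : Set E} (hK : IsClosed K)
    (h0 : ∀ y ∉ K, G y = 0) : ∀ y ∉ K, fderiv ℝ G y = 0 := by
  intro y hy
  have h1 : G =ᶠ[nhds y] (fun _ => 0) :=
    Filter.eventuallyEq_of_mem (hK.isOpen_compl.mem_nhds hy) h0
  rw [h1.fderiv_eq]
  simp

lemma integrable_of_supp {G : E → ℂ} {K : Set E} (hK : IsCompact K) (hG : Continuous G)
    (h0 : ∀ y ∉ K, G y = 0) : Integrable G ν :=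
  hG.integrable_of_hasCompactSupport (HasCompactSupport.intro hK h0)

lemma integral_fderiv_zero {G : E → ℂ} {K : Set E} (hK : IsCompact K)
    (hG : ContDiff ℝ (⊤ : ℕ∞) G) (h0 : ∀ y ∉ K, G y = 0) (v : E) :
    ∫ y, fderiv ℝ G y v ∂ν = 0 := by
  have h1 := integral_smul_fderiv_eq_neg_fderiv_smul_of_integrable (μ := ν) (𝕜 := ℝ)
    (f := fun _ => (1 : ℝ)) (g := G) (v := v) (by simp)
    (by
      simp only [one_smul]
      refine integrable_of_supp ν hK ?_ (fun y hy => by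
        rw [fderiv_zero_of_supp hK.isClosed h0 y hy]; rfl)
      exact (hG.continuous_fderiv (by simp)).clm_apply continuous_const)
    (by simpa using integrable_of_supp ν hK hG.continuous h0)
    (fun x _ => differentiableAt_const _) (fun x _ => hG.differentiable (by simp) x)
  simpa using h1

/-- One step of integration by parts. -/
lemma ibp_step {φ : E → ℝ} {f : E → ℂ} {U K : Set E} (hU : IsOpen U) (hK : IsCompact K)
    (hKU : K ⊆ U) (hφ : ContDiffOn ℝ (⊤ : ℕ∞) φ U) (hf : ContDiff ℝ (⊤ : ℕ∞) f)
    (h0 : ∀ y ∉ K, f y = 0) (e : E) {D : ℝ} (hD : 0 < D)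
    (ha : ∀ y ∈ U, fderiv ℝ φ y e ≠ 0) :
    ContDiff ℝ (⊤ : ℕ∞) (fun y => fderiv ℝ
        (fun y => f y * (((fderiv ℝ φ y e / D : ℝ) : ℂ))⁻¹) y e) ∧
    (∀ y ∉ K, fderiv ℝ (fun y => f y * (((fderiv ℝ φ y e / D : ℝ) : ℂ))⁻¹) y e = 0) ∧
    ‖∫ y, Complex.exp (((2 * Real.pi * φ y : ℝ) : ℂ) * I) * f y ∂ν‖ ≤
      D⁻¹ * ‖∫ y, Complex.exp (((2 * Real.pi * φ y : ℝ) : ℂ) * I) *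
        fderiv ℝ (fun y => f y * (((fderiv ℝ φ y e / D : ℝ) : ℂ))⁻¹) y e ∂ν‖ := by
  set a : E → ℂ := fun y => (((fderiv ℝ φ y e / D : ℝ) : ℂ)) with ha_def
  have ha0 : ∀ y ∈ U, a y ≠ 0 := fun y hy => by
    simp only [ha_def, ne_eq, Complex.ofReal_eq_zero, div_eq_zero_iff, not_or]
    exact ⟨ha y hy, hD.ne'⟩
  have hφ' : ContDiffOn ℝ (⊤ : ℕ∞) (fun y => fderiv ℝ φ y e) U :=
    (hφ.fderiv_of_isOpen hU (by simp)).clm_apply contDiffOn_const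
  have haS : ContDiffOn ℝ (⊤ : ℕ∞) a U := by
    have := (hφ'.div_const D)
    exact Complex.ofRealCLM.contDiff.comp_contDiffOn this
  set w : E → ℂ := fun y => f y * (a y)⁻¹ with hw_def
  have hw0 : ∀ y ∉ K, w y = 0 := fun y hy => by simp [hw_def, h0 y hy]
  have hwS : ContDiff ℝ (⊤ : ℕ∞) w :=
    contDiff_of_supp hU hK.isClosed hKU (hf.contDiffOn.mul (haS.inv ha0)) hw0
  have hw'S : ContDiff ℝ (⊤ : ℕ∞) (fun y => fderiv ℝ w y e) :=
    (hwS.fderiv_right (m := (⊤ : ℕ∞)) (by simp)).clm_apply contDiff_const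
  have hw'0 : ∀ y ∉ K, fderiv ℝ w y e = 0 := fun y hy => by
    rw [fderiv_zero_of_supp hK.isClosed hw0 y hy]; rfl
  refine ⟨hw'S, hw'0, ?_⟩
  set X : E → ℂ := fun y => Complex.exp (((2 * Real.pi * φ y : ℝ) : ℂ) * I) with hX
  have hXS : ContDiffOn ℝ (⊤ : ℕ∞) X U := by
    have h1 : ContDiffOn ℝ (⊤ : ℕ∞) (fun y => (((2 * Real.pi * φ y : ℝ) : ℂ) * I)) U :=
      (Complex.ofRealCLM.contDiff.comp_contDiffOn (contDiffOn_const.mul hφ)).mul contDiffOn_const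
    exact h1.cexp
  have hXw : ContDiff ℝ (⊤ : ℕ∞) (fun y => X y * w y) :=
    contDiff_of_supp hU hK.isClosed hKU (hXS.mul hwS.contDiffOn) (fun y hy => by simp [hw0 y hy])
  have hXf : ContDiff ℝ (⊤ : ℕ∞) (fun y => X y * f y) :=
    contDiff_of_supp hU hK.isClosed hKU (hXS.mul hf.contDiffOn) (fun y hy => by simp [h0 y hy])
  have hXw' : ContDiff ℝ (⊤ : ℕ∞) (fun y => X y * fderiv ℝ w y e) :=
    contDiff_of_supp hU hK.isClosed hKU (hXS.mul hw'S.contDiffOn)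
      (fun y hy => by simp [hw'0 y hy])
  have hz := integral_fderiv_zero ν hK hXw (fun y hy => by simp [hw0 y hy]) e
  have hder : ∀ y, fderiv ℝ (fun y => X y * w y) y e =
      (2 * Real.pi * D * I : ℂ) * (X y * f y) + X y * fderiv ℝ w y e := by
    intro y
    by_cases hy : y ∈ U
    · have hφd : HasFDerivAt φ (fderiv ℝ φ y) y :=
        ((hφ.contDiffAt (hU.mem_nhds hy)).differentiableAt (by simp)).hasFDerivAt
      have h1 : HasFDerivAt (fun y => (((2 * Real.pi * φ y : ℝ) : ℂ)))
          (Complex.ofRealCLM.comp ((2 * Real.pi) • fderiv ℝ φ y)) y :=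
        Complex.ofRealCLM.hasFDerivAt.comp y (hφd.const_mul (2 * Real.pi))
      have h2 := (h1.mul_const I).cexp
      have h3 := (h2.mul (hwS.differentiable (by simp) y).hasFDerivAt)
      have h4 : HasFDerivAt (fun y => X y * w y) _ y := h3
      rw [h4.fderiv]
      have hfa : w y * ((fderiv ℝ φ y e : ℝ) : ℂ) = D * f y := by
        have h5 := ha0 y hy
        have h6 : ((fderiv ℝ φ y e : ℝ) : ℂ) = D * a y := by
          simp only [ha_def]
          rw [← Complex.ofReal_mul, mul_div_cancel₀ _ hD.ne']
        rw [h6, hw_def]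
        field_simp
      simp only [ContinuousLinearMap.add_apply, ContinuousLinearMap.smul_apply, smul_eq_mul,
        ContinuousLinearMap.comp_apply, Complex.ofRealCLM_apply, hX, Complex.ofReal_mul,
        Complex.ofReal_ofNat, MulOpposite.smul_eq_mul_unop, MulOpposite.unop_op]
      linear_combination (2 * Real.pi * I * Complex.exp (2 * Real.pi * φ y * I)) * hfa
    · have hyK : y ∉ K := fun h => hy (hKU h)
      rw [fderiv_zero_of_supp (K := K) hK.isClosed (fun y hy => by simp [hw0 y hy]) y hyK, h0 y hyK,
        hw'0 y hyK]
      simp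
  simp only [hder] at hz
  rw [integral_add ((integrable_of_supp ν hK hXf.continuous
    (fun y hy => by simp [h0 y hy])).const_mul _)
    (integrable_of_supp ν hK hXw'.continuous (fun y hy => by simp [hw'0 y hy])),
    integral_const_mul] at hz
  have h7 := eq_neg_of_add_eq_zero_left hz
  have h8 := congrArg norm h7
  rw [norm_neg, norm_mul] at h8
  have h9 : ‖(2 * Real.pi * D * I : ℂ)‖ = 2 * Real.pi * D := by
    simp [abs_of_pos Real.pi_pos, abs_of_pos hD]
  rw [h9] at h8
  rw [← h8, ← mul_assoc]
  have h10 : (1 : ℝ) ≤ D⁻¹ * (2 * Real.pi * D) := by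
    have : D⁻¹ * (2 * Real.pi * D) = 2 * Real.pi := by field_simp
    rw [this]
    have := Real.pi_gt_three
    linarith
  exact le_mul_of_one_le_left (norm_nonneg _) h10

/-- Non-stationary phase, uniform in a family. -/
lemma nsp {ι : Type} (z : ι → E) (e : ι → E) (D : ι → ℝ) (hD : ∀ i, 0 < D i)
    (φ : ι → E → ℝ) (hφ : ∀ i, ContDiffOn ℝ (⊤ : ℕ∞) (φ i) (Metric.ball (z i) 1))
    (ha1 : ∀ i, ∀ y ∈ Metric.ball (z i) 1, 1 / 2 ≤ |fderiv ℝ (φ i) y (e i) / D i|)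
    (ha : ∀ n, BddC (fun i => Metric.ball (z i) 1) e n
      (fun i y => ((fderiv ℝ (φ i) y (e i) / D i : ℝ) : ℂ))) (N : ℕ) :
    ∀ (f : ι → E → ℂ), (∀ i, ContDiff ℝ (⊤ : ℕ∞) (f i)) →
      (∀ i, ∀ y ∉ Metric.closedBall (z i) (1 / 2), f i y = 0) →
      (∀ n, BddC (fun i => Metric.ball (z i) 1) e n f) →
      ∃ C : ℝ, ∀ i, ‖∫ y, Complex.exp (((2 * Real.pi * φ i y : ℝ) : ℂ) * I) * f i y ∂ν‖ ≤
        C * (D i)⁻¹ ^ N := by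
  have hU : ∀ i, IsOpen (Metric.ball (z i) (1 : ℝ)) := fun i => Metric.isOpen_ball
  induction N with
  | zero =>
    intro f hf h0 hb
    obtain ⟨C, hC⟩ := (hb 0).bound
    refine ⟨C * (ν (Metric.closedBall 0 (1 / 2))).toReal, fun i => ?_⟩
    rw [pow_zero, mul_one]
    have h1 : ∫ y, Complex.exp (((2 * Real.pi * φ i y : ℝ) : ℂ) * I) * f i y ∂ν =
      ∫ y in Metric.closedBall (z i) (1 / 2),
        Complex.exp (((2 * Real.pi * φ i y : ℝ) : ℂ) * I) * f i y ∂ν := by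
      rw [setIntegral_eq_integral_of_forall_compl_eq_zero]
      intro y hy
      rw [h0 i y hy, mul_zero]
    rw [h1]
    have h2 := norm_setIntegral_le_of_norm_le_const (μ := ν) (s := Metric.closedBall (z i) (1 / 2))
      (f := fun y => Complex.exp (((2 * Real.pi * φ i y : ℝ) : ℂ) * I) * f i y) (C := C)
      (by exact measure_closedBall_lt_top) (by
        intro y hy
        rw [norm_mul, Complex.norm_exp_ofReal_mul_I, one_mul]
        exact hC i y (Metric.closedBall_subset_ball (by norm_num) hy))
    have h3 : ν (Metric.closedBall (z i) (1 / 2)) = ν (Metric.closedBall 0 (1 / 2)) :=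
      Measure.addHaar_closedBall_center ν _ _
    rw [Measure.real, h3] at h2
    exact h2
  | succ N ih =>
    intro f hf h0 hb
    have hne : ∀ i, ∀ y ∈ Metric.ball (z i) 1, fderiv ℝ (φ i) y (e i) ≠ 0 := by
      intro i y hy h
      have := ha1 i y hy
      rw [h] at this
      norm_num at this
    have hstep := fun i => ibp_step ν (hU i) (isCompact_closedBall (z i) (1 / 2))
      (Metric.closedBall_subset_ball (by norm_num)) (hφ i) (hf i) (h0 i) (e i) (hD i) (hne i)
    have hb' : ∀ n, BddC (fun i => Metric.ball (z i) 1) e n (fun i y => fderiv ℝ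
        (fun y => f i y * (((fderiv ℝ (φ i) y (e i) / D i : ℝ) : ℂ))⁻¹) y (e i)) := by
      intro n
      have := BddC.mul hU (hb (n + 1)) (BddC.inv hU (c := 1 / 2) (by norm_num) (ha (n + 1)) (by
        intro i y hy
        rw [Complex.norm_real]
        exact ha1 i y hy))
      exact this.2.2
    obtain ⟨C, hC⟩ := ih _ (fun i => (hstep i).1) (fun i => (hstep i).2.1) hb'
    refine ⟨C, fun i => (hstep i).2.2.trans ?_⟩
    calc _ ≤ (D i)⁻¹ * (C * (D i)⁻¹ ^ N) := by
          have := hD i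
          gcongr
          exact hC i
      _ = C * (D i)⁻¹ ^ (N + 1) := by ring
end ibp
end SmoothEst

namespace SmoothEst

lemma BddC.hom' {E F : Type} [NormedAddCommGroup E] [NormedSpace ℝ E] [FiniteDimensional ℝ E]
    [NormedAddCommGroup F] [NormedSpace ℝ F] {ι : Type} {U : ι → Set E} {e : ι → E}
    (hU : ∀ i, IsOpen (U i)) (he : ∀ i, ‖e i‖ ≤ 1)
    (hU1 : ∀ i, ∀ y ∈ U i, 1 ≤ ‖y‖) (B : ℝ) {n : ℕ} {s : ℝ} {f : E → F}
    (hs : Smo f) (hf : Hom s f) (L : ι → F →ₗ[ℝ] ℂ) (c : ι → ℝ)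
    (hL : ∀ i T, ‖L i T‖ ≤ c i * ‖T‖) (hc0 : ∀ i, 0 ≤ c i)
    (hc : ∀ i, ∀ y ∈ U i, c i * ‖y‖ ^ s ≤ B) :
    BddC U e n (fun i y => L i (f y)) := by
  refine BddC.hom hU he hU1 B hs hf (fun i => (L i).mkContinuous (c i) (hL i)) ?_
  intro i y hy
  refine le_trans ?_ (hc i y hy)
  gcongr
  exact LinearMap.mkContinuous_norm_le _ (hc0 i) _

section loc
variable {E : Type} [NormedAddCommGroup E] [InnerProductSpace ℝ E] [FiniteDimensional ℝ E]
  [MeasurableSpace E] [BorelSpace E]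

/-- Polynomial weight. -/
def wt (N : ℕ) (v : E) : ℝ := (1 + ‖v‖) ^ N

lemma wt_pos (N : ℕ) (v : E) : 0 < wt N v := by unfold wt; positivity

/-- Weighted, localized product of windows. -/
def fam (N : ℕ) (g χ : SchwartzMap E ℂ) (x x' z y : E) : ℂ :=
  ((wt N (z - x') : ℂ) * g (y - x')) * ((wt N (z - x) : ℂ) * (starRingEnd ℂ) (g (y - x))) *
    χ (y - z)

lemma fam_bdd (N : ℕ) (g χ : SchwartzMap E ℂ) {ι : Type} (x x' z e : ι → E)
    (he : ∀ i, ‖e i‖ ≤ 1) (n : ℕ) :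
    BddC (fun i => Metric.ball (z i) 1) e n (fun i y => fam N g χ (x i) (x' i) (z i) y) := by
  have hU : ∀ i, IsOpen (Metric.ball (z i) (1 : ℝ)) := fun i => Metric.isOpen_ball
  have hUz : ∀ i, ∀ y ∈ Metric.ball (z i) (1 : ℝ), ‖y - z i‖ ≤ 1 := fun i y hy => by
    rw [← dist_eq_norm]; exact (Metric.mem_ball.1 hy).le
  have h1 := BddC.schwartz (U := fun i => Metric.ball (z i) (1 : ℝ)) N he z x' hUz (n := n) g
    (fun i => wt N (z i - x' i) • ContinuousLinearMap.id ℝ ℂ) (by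
      intro i
      refine ContinuousLinearMap.opNorm_le_bound _ (wt_pos N _).le fun v => ?_
      simp [Real.norm_of_nonneg (wt_pos N (z i - x' i)).le]
      exact le_rfl)
  have h2 := BddC.schwartz (U := fun i => Metric.ball (z i) (1 : ℝ)) N he z x hUz (n := n) g
    (fun i => wt N (z i - x i) • (Complex.conjCLE : ℂ →L[ℝ] ℂ)) (by
      intro i
      refine ContinuousLinearMap.opNorm_le_bound _ (wt_pos N _).le fun v => ?_
      simp [Real.norm_of_nonneg (wt_pos N (z i - x i)).le]
      exact le_rfl)
  have h3 := BddC.schwartz (U := fun i => Metric.ball (z i) (1 : ℝ)) 0 he z z hUz (n := n) χ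
    (fun i => ContinuousLinearMap.id ℝ ℂ) (by
      intro i
      simp)
  refine BddC.congr hU ?_ (BddC.mul hU (BddC.mul hU h1 h2) h3)
  intro i y _
  simp [fam]

lemma fam_smooth (N : ℕ) (g χ : SchwartzMap E ℂ) (x x' z : E) :
    ContDiff ℝ (⊤ : ℕ∞) (fun y => fam N g χ x x' z y) := by
  have h : ∀ (g : SchwartzMap E ℂ) (x : E), ContDiff ℝ (⊤ : ℕ∞) (fun y => g (y - x)) :=
    fun g x => (g.smooth ⊤).comp (contDiff_id.sub contDiff_const)
  unfold fam
  refine ((contDiff_const.mul (h g x')).mul (contDiff_const.mul ?_)).mul (h χ z)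
  exact (Complex.conjCLE : ℂ →L[ℝ] ℂ).contDiff.comp (h g x)

lemma triv_bound {f : E → ℂ} {z : E} {φ : E → ℝ} {C : ℝ}
    (hC : ∀ y ∈ Metric.ball z 1, ‖f y‖ ≤ C)
    (h0 : ∀ y ∉ Metric.closedBall z (1 / 2), f y = 0) :
    ‖∫ y, Complex.exp (((2 * Real.pi * φ y : ℝ) : ℂ) * I) * f y‖ ≤
      C * (volume (Metric.closedBall (0 : E) (1 / 2))).toReal := by
  have h1 : ∫ y, Complex.exp (((2 * Real.pi * φ y : ℝ) : ℂ) * I) * f y =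
      ∫ y in Metric.closedBall z (1 / 2),
        Complex.exp (((2 * Real.pi * φ y : ℝ) : ℂ) * I) * f y := by
    rw [setIntegral_eq_integral_of_forall_compl_eq_zero]
    intro y hy
    rw [h0 y hy, mul_zero]
  rw [h1]
  have h2 := norm_setIntegral_le_of_norm_le_const (μ := volume) (s := Metric.closedBall z (1 / 2))
    (f := fun y => Complex.exp (((2 * Real.pi * φ y : ℝ) : ℂ) * I) * f y) (C := C)
    (by exact measure_closedBall_lt_top) (by
      intro y hy
      rw [norm_mul, Complex.norm_exp_ofReal_mul_I, one_mul]
      exact hC y (Metric.closedBall_subset_ball (by norm_num) hy))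
  have h3 : volume (Metric.closedBall z (1 / 2)) = volume (Metric.closedBall (0 : E) (1 / 2)) :=
    Measure.addHaar_closedBall_center volume _ _
  rw [Measure.real, h3] at h2
  exact h2

/-- Gradient mismatch. -/
def Dm (μ : E → ℝ) (t : ℝ) (ζ z : E) : ℝ := ‖t • fderiv ℝ μ z - innerSL ℝ ζ‖

/-- Size of the Hessian. -/
def Mm (m t : ℝ) (z : E) : ℝ := max 1 (t * ‖z‖ ^ (m - 2))

lemma one_le_Mm (m t : ℝ) (z : E) : 1 ≤ Mm m t z := le_max_left _ _

open Classical in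
/-- The majorant. -/
def Sm (N : ℕ) (μ : E → ℝ) (m t : ℝ) (ζ z : E) : ℝ :=
  if ‖z‖ ≤ 2 then 1 else (1 + Dm μ t ζ z / Mm m t z)⁻¹ ^ N

lemma local_nsp {m : ℝ} (hm : 2 ≤ m) {μ : E → ℝ} (hs : Smo μ) (hh : Hom m μ)
    (N : ℕ) (g χ : SchwartzMap E ℂ) (hχ : ∀ y ∉ Metric.closedBall (0 : E) (1 / 2), χ y = 0) :
    ∃ C₁ : ℝ, 1 ≤ C₁ ∧ ∃ C : ℝ, ∀ t ζ x x' z, 0 < t → t ≤ 1 → 2 < ‖z‖ →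
      C₁ * Mm m t z ≤ Dm μ t ζ z →
      ‖∫ y, Complex.exp (((2 * Real.pi * (t * μ y - ⟪ζ, y⟫) : ℝ) : ℂ) * I) *
        fam N g χ x x' z y‖ ≤ C * (Dm μ t ζ z)⁻¹ ^ N := by
  obtain ⟨C2, hC20, hC2⟩ := ((hh.fderiv hs).fderiv hs.fderiv).bound hs.fderiv.fderiv
  have hexp : m - 1 - 1 = m - 2 := by ring
  rw [hexp] at hC2
  set A : ℝ := 2 ^ (m - 2) with hA
  have hA0 : 0 < A := by positivity
  refine ⟨2 * (C2 * A) + 1, by nlinarith [mul_nonneg hC20 hA0.le], ?_⟩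
  let ι : Type := {i : ℝ × E × E × E × E // 0 < i.1 ∧ i.1 ≤ 1 ∧ 2 < ‖i.2.2.2.2‖ ∧
    (2 * (C2 * A) + 1) * Mm m i.1 i.2.2.2.2 ≤ Dm μ i.1 i.2.1 i.2.2.2.2}
  let tt : ι → ℝ := fun i => i.1.1
  let ζ : ι → E := fun i => i.1.2.1
  let x : ι → E := fun i => i.1.2.2.1
  let x' : ι → E := fun i => i.1.2.2.2.1
  let z : ι → E := fun i => i.1.2.2.2.2
  let L : ι → E →L[ℝ] ℝ := fun i => tt i • fderiv ℝ μ (z i) - innerSL ℝ (ζ i)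
  let D : ι → ℝ := fun i => Dm μ (tt i) (ζ i) (z i)
  have ht : ∀ i, 0 < tt i := fun i => i.2.1
  have hz : ∀ i, 2 < ‖z i‖ := fun i => i.2.2.2.1
  have hDM : ∀ i, (2 * (C2 * A) + 1) * Mm m (tt i) (z i) ≤ D i := fun i => i.2.2.2.2
  have hD1 : ∀ i, Mm m (tt i) (z i) ≤ D i := fun i => by
    have := hDM i
    have h1 := one_le_Mm m (tt i) (z i)
    nlinarith [mul_nonneg hC20 hA0.le, mul_nonneg (mul_nonneg hC20 hA0.le) (zero_le_one.trans h1)]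
  have hD : ∀ i, 0 < D i := fun i => by linarith [hD1 i, one_le_Mm m (tt i) (z i)]
  have hR : ∀ i, tt i * ‖z i‖ ^ (m - 2) ≤ Mm m (tt i) (z i) := fun i => le_max_right _ _
  let e : ι → E := fun i => (D i)⁻¹ • (InnerProductSpace.toDual ℝ E).symm (L i)
  have he : ∀ i, ‖e i‖ ≤ 1 := fun i => by
    have h1 : ‖L i‖ = D i := rfl
    simp only [e, norm_smul, LinearIsometryEquiv.norm_map, norm_inv, h1,
      Real.norm_of_nonneg (hD i).le]
    rw [inv_mul_cancel₀ (hD i).ne']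
  have hLe : ∀ i, L i (e i) = D i := fun i => by
    have h1 : ‖L i‖ = D i := rfl
    have h2 : L i ((InnerProductSpace.toDual ℝ E).symm (L i)) = D i * D i := by
      rw [← InnerProductSpace.toDual_symm_apply, real_inner_self_eq_norm_mul_norm,
        LinearIsometryEquiv.norm_map, h1]
    simp only [e, map_smul, h2, smul_eq_mul]
    field_simp [(hD i).ne']
  have hy1 : ∀ i, ∀ y ∈ Metric.ball (z i) (1 : ℝ), 1 ≤ ‖y‖ := fun i y hy => by
    have h1 := Metric.mem_ball.1 hy
    rw [dist_eq_norm] at h1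
    have h2 := norm_sub_norm_le (z i) y
    rw [norm_sub_rev] at h2
    linarith [hz i]
  have hy0 : ∀ i, ∀ y ∈ Metric.ball (z i) (1 : ℝ), y ≠ 0 := fun i y hy h => by
    have := hy1 i y hy; rw [h] at this; norm_num at this
  have hyz : ∀ i, ∀ y ∈ Metric.ball (z i) (1 : ℝ), ‖y‖ ^ (m - 2) ≤ A * ‖z i‖ ^ (m - 2) :=
    fun i y hy => by
    have h1 := Metric.mem_ball.1 hy
    rw [dist_eq_norm] at h1
    have h2 := norm_sub_norm_le y (z i)
    have h3 : ‖y‖ ≤ 2 * ‖z i‖ := by linarith [hz i]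
    rw [hA, ← Real.mul_rpow (by norm_num) (norm_nonneg _)]
    exact Real.rpow_le_rpow (norm_nonneg _) h3 (by linarith)
  let φ : ι → E → ℝ := fun i y => tt i * μ y - ⟪ζ i, y⟫
  have hφd : ∀ i, ∀ y, y ≠ 0 → HasFDerivAt (φ i) (tt i • fderiv ℝ μ y - innerSL ℝ (ζ i)) y :=
    fun i y hy => ((hs.diff hy).hasFDerivAt.const_mul (tt i)).sub (innerSL ℝ (ζ i)).hasFDerivAt
  have hφs : ∀ i, ContDiffOn ℝ (⊤ : ℕ∞) (φ i) (Metric.ball (z i) 1) := fun i =>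
    (contDiffOn_const.mul (ContDiffOn.mono hs (fun y hy => hy0 i y hy))).sub
      (innerSL ℝ (ζ i)).contDiff.contDiffOn
  have hfd : ∀ i, ∀ y ∈ Metric.ball (z i) (1 : ℝ), fderiv ℝ (φ i) y (e i) / D i =
      (tt i * fderiv ℝ μ y (e i) - ⟪ζ i, e i⟫) / D i := fun i y hy => by
    rw [(hφd i y (hy0 i y hy)).fderiv]
    rfl
  have hdev : ∀ i, ∀ y ∈ Metric.ball (z i) (1 : ℝ), |fderiv ℝ (φ i) y (e i) / D i - 1| ≤ 1 / 2 := by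
    intro i y hy
    have h1 : ‖fderiv ℝ μ y - fderiv ℝ μ (z i)‖ ≤ (C2 * (A * ‖z i‖ ^ (m - 2))) * ‖y - z i‖ := by
      refine (convex_ball (z i) (1 : ℝ)).norm_image_sub_le_of_norm_fderiv_le (𝕜 := ℝ)
        (fun w hw => hs.fderiv.diff (hy0 i w hw)) (fun w hw => ?_)
        (Metric.mem_ball_self one_pos) hy
      refine (hC2 w (hy0 i w hw)).trans ?_
      gcongr
      exact hyz i w hw
    have hyn : ‖y - z i‖ ≤ 1 := by
      rw [← dist_eq_norm]; exact (Metric.mem_ball.1 hy).le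
    have h2 : ‖fderiv ℝ μ y - fderiv ℝ μ (z i)‖ ≤ C2 * (A * ‖z i‖ ^ (m - 2)) := by
      refine h1.trans (mul_le_of_le_one_right ?_ hyn)
      positivity
    have h3 : fderiv ℝ (φ i) y (e i) / D i - 1 =
        (tt i * (fderiv ℝ μ y - fderiv ℝ μ (z i)) (e i)) / D i := by
      have h4 := hLe i
      have h5 : L i (e i) = tt i * fderiv ℝ μ (z i) (e i) - ⟪ζ i, e i⟫ := rfl
      rw [hfd i y hy, sub_eq_iff_eq_add]
      have h6 : (fderiv ℝ μ y - fderiv ℝ μ (z i)) (e i) =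
        fderiv ℝ μ y (e i) - fderiv ℝ μ (z i) (e i) := rfl
      have h7 := (hD i).ne'
      rw [h6]
      field_simp
      linarith
    rw [h3, abs_div, abs_of_pos (hD i), div_le_iff₀ (hD i), abs_mul, abs_of_pos (ht i)]
    have h4 : |(fderiv ℝ μ y - fderiv ℝ μ (z i)) (e i)| ≤ C2 * (A * ‖z i‖ ^ (m - 2)) := by
      have h40 := (fderiv ℝ μ y - fderiv ℝ μ (z i)).le_opNorm (e i)
      rw [Real.norm_eq_abs] at h40
      refine h40.trans ?_
      exact (mul_le_of_le_one_right (norm_nonneg _) (he i)).trans h2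
    calc tt i * |(fderiv ℝ μ y - fderiv ℝ μ (z i)) (e i)|
        ≤ tt i * (C2 * (A * ‖z i‖ ^ (m - 2))) := by
          have := (ht i).le
          gcongr
      _ = (C2 * A) * (tt i * ‖z i‖ ^ (m - 2)) := by ring
      _ ≤ (C2 * A) * Mm m (tt i) (z i) := by gcongr; exact hR i
      _ ≤ 1 / 2 * D i := by
          have := hDM i
          have := one_le_Mm m (tt i) (z i)
          nlinarith
  have ha1 : ∀ i, ∀ y ∈ Metric.ball (z i) 1, 1 / 2 ≤ |fderiv ℝ (φ i) y (e i) / D i| := by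
    intro i y hy
    have h1 := (abs_le.1 (hdev i y hy)).1
    have h2 := le_abs_self (fderiv ℝ (φ i) y (e i) / D i)
    linarith
  have hU : ∀ i, IsOpen (Metric.ball (z i) (1 : ℝ)) := fun i => Metric.isOpen_ball
  have hab : ∃ C : ℝ, ∀ i, ∀ y ∈ Metric.ball (z i) 1,
      ‖((fderiv ℝ (φ i) y (e i) / D i : ℝ) : ℂ)‖ ≤ C := by
    refine ⟨3 / 2, fun i y hy => ?_⟩
    rw [Complex.norm_real, Real.norm_eq_abs]
    have h1 := abs_le.1 (hdev i y hy)
    exact abs_le.2 ⟨by linarith, by linarith⟩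
  have ha : ∀ n, BddC (fun i => Metric.ball (z i) 1) e n
      (fun i y => ((fderiv ℝ (φ i) y (e i) / D i : ℝ) : ℂ)) := by
    intro n
    cases n with
    | zero => exact hab
    | succ n =>
      let Λ : ι → (E →L[ℝ] E →L[ℝ] ℝ) →ₗ[ℝ] ℂ := fun i =>
        { toFun := fun T => (((tt i / D i) * T (e i) (e i) : ℝ) : ℂ)
          map_add' := fun S T => by simp [mul_add]
          map_smul' := fun c T => by simp; ring }
      have hΛ : ∀ i T, ‖Λ i T‖ ≤ tt i / D i * ‖T‖ := by
        intro i T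
        have h0 : 0 ≤ tt i / D i := div_nonneg (ht i).le (hD i).le
        have h1 : ‖Λ i T‖ = (tt i / D i) * ‖T (e i) (e i)‖ := by
          change ‖(((tt i / D i) * T (e i) (e i) : ℝ) : ℂ)‖ = _
          rw [Complex.norm_real, norm_mul, Real.norm_of_nonneg h0]
        rw [h1]
        refine mul_le_mul_of_nonneg_left ?_ h0
        refine ((T (e i)).le_opNorm (e i)).trans ?_
        refine (mul_le_of_le_one_right (norm_nonneg _) (he i)).trans ?_
        exact (T.le_opNorm (e i)).trans (mul_le_of_le_one_right (norm_nonneg _) (he i))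
      have hb := BddC.hom' (U := fun i => Metric.ball (z i) (1 : ℝ)) hU he hy1 A (n := n)
        hs.fderiv.fderiv ((hh.fderiv hs).fderiv hs.fderiv) Λ _ hΛ (fun i => div_nonneg (ht i).le (hD i).le) (by
          intro i y hy
          rw [hexp]
          have h0 : 0 ≤ tt i / D i := div_nonneg (ht i).le (hD i).le
          calc (tt i / D i) * ‖y‖ ^ (m - 2) ≤ (tt i / D i) * (A * ‖z i‖ ^ (m - 2)) := by
                gcongr
                exact hyz i y hy
            _ = A * ((tt i * ‖z i‖ ^ (m - 2)) / D i) := by ring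
            _ ≤ A * 1 := by
                gcongr
                rw [div_le_one (hD i)]
                exact (hR i).trans (hD1 i)
            _ = A := mul_one _)
      have hda : ∀ i, ∀ y ∈ Metric.ball (z i) (1 : ℝ),
          HasFDerivAt (fun y => ((fderiv ℝ (φ i) y (e i) / D i : ℝ) : ℂ))
          ((tt i / D i) • (Complex.ofRealCLM.comp ((ContinuousLinearMap.apply ℝ ℝ (e i)).comp
            (fderiv ℝ (fderiv ℝ μ) y)))) y := by
        intro i y hy
        have h1 : HasFDerivAt (fun y => (tt i * fderiv ℝ μ y (e i) - ⟪ζ i, e i⟫) / D i)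
            ((D i)⁻¹ • (tt i • ((ContinuousLinearMap.apply ℝ ℝ (e i)).comp
            (fderiv ℝ (fderiv ℝ μ) y)))) y := by
          have h2 := (ContinuousLinearMap.apply ℝ ℝ (e i)).hasFDerivAt.comp y
            (hs.fderiv.diff (hy0 i y hy)).hasFDerivAt
          have h3 := ((h2.const_mul (tt i)).sub_const (⟪ζ i, e i⟫)).mul_const ((D i)⁻¹)
          simpa [div_eq_mul_inv] using h3
        have h4 := Complex.ofRealCLM.hasFDerivAt.comp y h1
        have h5 : Complex.ofRealCLM.comp ((D i)⁻¹ • (tt i •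
            ((ContinuousLinearMap.apply ℝ ℝ (e i)).comp (fderiv ℝ (fderiv ℝ μ) y)))) =
            ((tt i / D i) • (Complex.ofRealCLM.comp ((ContinuousLinearMap.apply ℝ ℝ (e i)).comp
            (fderiv ℝ (fderiv ℝ μ) y)))) := by
          rw [smul_smul, ContinuousLinearMap.comp_smul, div_eq_inv_mul]
        rw [h5] at h4
        refine h4.congr_of_eventuallyEq ?_
        refine Filter.eventuallyEq_of_mem ((hU i).mem_nhds hy) (fun w hw => ?_)
        simp only [Function.comp_apply, Complex.ofRealCLM_apply]
        rw [hfd i w hw]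
      refine ⟨hab, fun i y hy => (hda i y hy).differentiableAt, ?_⟩
      refine BddC.congr hU ?_ hb
      intro i y hy
      rw [(hda i y hy).fderiv]
      change (((tt i / D i) * (fderiv ℝ (fderiv ℝ μ) y) (e i) (e i) : ℝ) : ℂ) = _
      simp
  obtain ⟨C, hC⟩ := nsp volume z e D hD φ hφs ha1 ha N
    (fun i y => fam N g χ (x i) (x' i) (z i) y) (fun i => fam_smooth N g χ _ _ _)
    (by
      intro i y hy
      unfold fam
      rw [hχ (y - z i) (by simpa [dist_eq_norm] using hy), mul_zero])
    (fam_bdd N g χ x x' z e he)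
  refine ⟨C, fun t ζ x x' z h1 h2 h3 h4 => ?_⟩
  exact hC ⟨(t, ζ, x, x', z), h1, h2, h3, h4⟩

lemma local_est {m : ℝ} (hm : 2 ≤ m) {μ : E → ℝ} (hs : Smo μ) (hh : Hom m μ)
    (N : ℕ) (g χ : SchwartzMap E ℂ) (hχ : ∀ y ∉ Metric.closedBall (0 : E) (1 / 2), χ y = 0) :
    ∃ C : ℝ, 0 ≤ C ∧ ∀ t ζ x x' z, 0 < t → t ≤ 1 →
      ‖∫ y, Complex.exp (((2 * Real.pi * (t * μ y - ⟪ζ, y⟫) : ℝ) : ℂ) * I) *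
        (g (y - x') * (starRingEnd ℂ) (g (y - x)) * χ (y - z))‖ ≤
      C * ((wt N (z - x'))⁻¹ * (wt N (z - x))⁻¹ * Sm N μ m t ζ z) := by
  obtain ⟨C₁, hC₁, C, hC⟩ := local_nsp hm hs hh N g χ hχ
  obtain ⟨B, hB⟩ := (fam_bdd N g χ (fun i : E × E × E => i.1) (fun i => i.2.1) (fun i => i.2.2)
    (fun _ => 0) (by simp) 0).bound
  set V := (volume (Metric.closedBall (0 : E) (1 / 2))).toReal
  have hV : 0 ≤ V := ENNReal.toReal_nonneg
  have hB0 : 0 ≤ B := (norm_nonneg _).trans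
    (hB (0, 0, 0) 0 (Metric.mem_ball_self one_pos))
  set K := max (B * V * (1 + C₁) ^ N) (max C 0 * 2 ^ N) with hK
  refine ⟨K, le_trans (by positivity) (le_max_left _ _), fun t ζ x x' z ht ht1 => ?_⟩
  have hS : ‖∫ y, Complex.exp (((2 * Real.pi * (t * μ y - ⟪ζ, y⟫) : ℝ) : ℂ) * I) *
        fam N g χ x x' z y‖ ≤ K * Sm N μ m t ζ z := by
    have htriv := triv_bound (f := fun y => fam N g χ x x' z y) (z := z)
      (φ := fun y => t * μ y - ⟪ζ, y⟫) (C := B) (fun y hy => hB (x, x', z) y hy) (by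
      intro y hy
      unfold fam
      rw [hχ (y - z) (by simpa [dist_eq_norm] using hy), mul_zero])
    have hD0 : 0 ≤ Dm μ t ζ z := norm_nonneg _
    have hM1 := one_le_Mm m t z
    have hM0 : 0 < Mm m t z := by linarith
    unfold Sm
    split_ifs with hz
    · rw [mul_one]
      refine htriv.trans (le_trans ?_ (le_max_left _ _))
      refine le_mul_of_one_le_right (by positivity) ?_
      exact one_le_pow₀ (by linarith)
    · push Not at hz
      by_cases hD : C₁ * Mm m t z ≤ Dm μ t ζ z
      · refine (hC t ζ x x' z ht ht1 hz hD).trans ?_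
        have hDM : Mm m t z ≤ Dm μ t ζ z := by nlinarith
        have hDp : 0 < Dm μ t ζ z := by linarith
        have h1 : (Dm μ t ζ z)⁻¹ ≤ 2 * (1 + Dm μ t ζ z / Mm m t z)⁻¹ := by
          rw [← div_eq_mul_inv, inv_eq_one_div, div_le_div_iff₀ hDp (by positivity)]
          have : Dm μ t ζ z / Mm m t z ≤ Dm μ t ζ z := div_le_self hD0 hM1
          linarith
        calc C * (Dm μ t ζ z)⁻¹ ^ N ≤ max C 0 * (2 * (1 + Dm μ t ζ z / Mm m t z)⁻¹) ^ N := by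
              gcongr
              exact le_max_left _ _
          _ = max C 0 * 2 ^ N * (1 + Dm μ t ζ z / Mm m t z)⁻¹ ^ N := by rw [mul_pow]; ring
          _ ≤ _ := by
              gcongr
              exact le_max_right _ _
      · push Not at hD
        refine htriv.trans ?_
        have h1 : Dm μ t ζ z / Mm m t z ≤ C₁ := by
          rw [div_le_iff₀ hM0]; exact hD.le
        have h2 : 1 ≤ (1 + C₁) ^ N * (1 + Dm μ t ζ z / Mm m t z)⁻¹ ^ N := by
          rw [← mul_pow]
          refine one_le_pow₀ ?_
          rw [← div_eq_mul_inv, le_div_iff₀ (by positivity)]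
          linarith
        calc B * V ≤ B * V * ((1 + C₁) ^ N * (1 + Dm μ t ζ z / Mm m t z)⁻¹ ^ N) :=
              le_mul_of_one_le_right (by positivity) h2
          _ = B * V * (1 + C₁) ^ N * (1 + Dm μ t ζ z / Mm m t z)⁻¹ ^ N := by ring
          _ ≤ _ := by
              gcongr
              exact le_max_left _ _
  have h1 := wt_pos N (z - x')
  have h2 := wt_pos N (z - x)
  have heq : ∫ y, Complex.exp (((2 * Real.pi * (t * μ y - ⟪ζ, y⟫) : ℝ) : ℂ) * I) *
        fam N g χ x x' z y = ((wt N (z - x') * wt N (z - x) : ℝ) : ℂ) *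
      ∫ y, Complex.exp (((2 * Real.pi * (t * μ y - ⟪ζ, y⟫) : ℝ) : ℂ) * I) *
        (g (y - x') * (starRingEnd ℂ) (g (y - x)) * χ (y - z)) := by
    rw [← integral_const_mul]
    congr 1
    funext y
    unfold fam
    push_cast
    ring
  rw [heq, norm_mul, Complex.norm_real, Real.norm_of_nonneg (by positivity)] at hS
  have h3 : K * ((wt N (z - x'))⁻¹ * (wt N (z - x))⁻¹ * Sm N μ m t ζ z) =
    (K * Sm N μ m t ζ z) / (wt N (z - x') * wt N (z - x)) := by
    field_simp
  rw [h3, le_div_iff₀ (by positivity), mul_comm]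
  exact hS
end loc
end SmoothEst

namespace SmoothEst

section geo
variable {E F : Type} [NormedAddCommGroup E] [NormedSpace ℝ E] [FiniteDimensional ℝ E]
    [NormedAddCommGroup F] [NormedSpace ℝ F]

lemma hess_inj {Φ : E → F} {s : ℝ} (hs : Smo Φ) (hh : Hom s Φ)
    (hi : ∀ x : E, ‖x‖ = 1 → Function.Injective (fderiv ℝ Φ x)) {x : E} (hx : x ≠ 0) :
    Function.Injective (fderiv ℝ Φ x) := by
  have hx' : 0 < ‖x‖ := norm_pos_iff.2 hx
  have hu : ‖‖x‖⁻¹ • x‖ = 1 := by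
    rw [norm_smul, norm_inv, norm_norm, inv_mul_cancel₀ hx'.ne']
  have hu0 : ‖x‖⁻¹ • x ≠ 0 := fun h => by rw [h] at hu; simp at hu
  have h1 := (hh.fderiv hs) ‖x‖ hx' (‖x‖⁻¹ • x) hu0
  rw [smul_smul, mul_inv_cancel₀ hx'.ne', one_smul] at h1
  rw [h1]
  intro v w hvw
  refine hi _ hu ?_
  have h2 : ‖x‖ ^ (s - 1) ≠ 0 := (Real.rpow_pos_of_pos hx' _).ne'
  have h3 : ‖x‖ ^ (s - 1) • (fderiv ℝ Φ (‖x‖⁻¹ • x)) v =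
    ‖x‖ ^ (s - 1) • (fderiv ℝ Φ (‖x‖⁻¹ • x)) w := hvw
  exact smul_right_injective F h2 h3

lemma local_antilip {Φ : E → F} (hs : Smo Φ) {x : E} (hx : x ≠ 0)
    (hi : Function.Injective (fderiv ℝ Φ x)) :
    ∃ c > 0, ∃ ρ > 0, ∀ v ∈ Metric.closedBall x ρ, v ≠ 0 ∧ ∀ w ∈ Metric.closedBall x ρ,
      ‖v - w‖ ≤ c * ‖Φ v - Φ w‖ := by
  obtain ⟨K, hK, hKa⟩ := LinearMap.exists_antilipschitzWith
    ((fderiv ℝ Φ x : E →L[ℝ] F) : E →ₗ[ℝ] F) (LinearMap.ker_eq_bot.2 hi)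
  have hst : HasStrictFDerivAt Φ (fderiv ℝ Φ x) x :=
    (hs.contDiffAt hx).hasStrictFDerivAt (by simp)
  obtain ⟨U, hU, hUa⟩ := hst.approximates_deriv_on_nhds (c := (2 * K)⁻¹)
    (Or.inr (by positivity))
  have hU2 : U ∩ {x | x ≠ 0} ∈ nhds x := Filter.inter_mem hU (isOpen_ne0.mem_nhds hx)
  obtain ⟨ρ, hρ, hρU⟩ := Metric.nhds_basis_closedBall.mem_iff.1 hU2
  refine ⟨2 * K, by positivity, ρ, hρ, fun v hv => ⟨(hρU hv).2, fun w hw => ?_⟩⟩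
  have h1 := hUa v (hρU hv).1 w (hρU hw).1
  have h2 := hKa.le_mul_dist v w
  rw [dist_eq_norm, dist_eq_norm] at h2
  have h3 : ‖(fderiv ℝ Φ x) v - (fderiv ℝ Φ x) w‖ ≤ ‖Φ v - Φ w‖ +
      ‖Φ v - Φ w - (fderiv ℝ Φ x) (v - w)‖ := by
    have h4 := norm_sub_le (Φ v - Φ w) (Φ v - Φ w - (fderiv ℝ Φ x) (v - w))
    rw [sub_sub_cancel, map_sub] at h4
    rw [map_sub]
    exact h4
  have hK' : (0 : ℝ) < K := hK
  push_cast at h1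
  have h5 : ‖v - w‖ ≤ K * (‖Φ v - Φ w‖ + (2 * (K : ℝ))⁻¹ * ‖v - w‖) :=
    h2.trans (by gcongr; exact h3.trans (by gcongr))
  have h6 : (K : ℝ) * ((2 * (K : ℝ))⁻¹ * ‖v - w‖) = ‖v - w‖ / 2 := by field_simp
  rw [mul_add, h6] at h5
  linarith

lemma annulus {Φ : E → F} (hs : Smo Φ)
    (hi : ∀ x : E, x ≠ 0 → Function.Injective (fderiv ℝ Φ x)) (a b : ℝ) (ha : 0 < a) :
    ∃ (T : Finset E) (C : ℝ), 0 ≤ C ∧ ∀ η : F, ∃ pts : E → E, ∀ v, a ≤ ‖v‖ → ‖v‖ ≤ b →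
      ∃ j ∈ T, ‖v - pts j‖ ≤ C * ‖Φ v - η‖ := by
  have h0 : ∀ x : E, ∃ c > 0, ∃ ρ > 0, x ≠ 0 → ∀ v ∈ Metric.closedBall x ρ, v ≠ 0 ∧
      ∀ w ∈ Metric.closedBall x ρ, ‖v - w‖ ≤ c * ‖Φ v - Φ w‖ := by
    intro x
    by_cases hx : x = 0
    · exact ⟨1, one_pos, 1, one_pos, fun h => absurd hx h⟩
    · obtain ⟨c, hc, ρ, hρ, h⟩ := local_antilip hs hx (hi x hx)
      exact ⟨c, hc, ρ, hρ, fun _ => h⟩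
  choose c hc ρ hρ hloc using h0
  have hcomp : IsCompact {v : E | a ≤ ‖v‖ ∧ ‖v‖ ≤ b} := by
    refine (isCompact_closedBall (0 : E) b).of_isClosed_subset ?_ (fun v hv => by simpa using hv.2)
    exact (isClosed_le continuous_const continuous_norm).inter
      (isClosed_le continuous_norm continuous_const)
  obtain ⟨T, hT, hcov⟩ := hcomp.elim_nhds_subcover (fun x => Metric.closedBall x (ρ x))
    (fun x _ => Metric.closedBall_mem_nhds x (hρ x))
  have hT0 : ∀ x ∈ T, x ≠ 0 := fun x hx h => by
    have := (hT x hx).1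
    rw [h, norm_zero] at this
    linarith
  refine ⟨T, ∑ x ∈ T, c x * 2, Finset.sum_nonneg fun x _ => by have := hc x; positivity,
    fun η => ?_⟩
  have hmin : ∀ x : E, ∃ w, x ≠ 0 → w ∈ Metric.closedBall x (ρ x) ∧
      ∀ v ∈ Metric.closedBall x (ρ x), ‖Φ w - η‖ ≤ ‖Φ v - η‖ := by
    intro x
    by_cases hx : x = 0
    · exact ⟨0, fun h => absurd hx h⟩
    · have hcont : ContinuousOn (fun v => ‖Φ v - η‖) (Metric.closedBall x (ρ x)) := fun v hv =>
        ((((hs.contDiffAt (hloc x hx v hv).1).continuousAt).sub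
          continuousAt_const).norm).continuousWithinAt
      obtain ⟨w, hw, hwm⟩ := (isCompact_closedBall x (ρ x)).exists_isMinOn
        ⟨x, Metric.mem_closedBall_self (hρ x).le⟩ hcont
      exact ⟨w, fun _ => ⟨hw, fun v hv => hwm hv⟩⟩
  choose pts hpts using hmin
  refine ⟨pts, fun v hva hvb => ?_⟩
  obtain ⟨x, hxT, hvx⟩ := Set.mem_iUnion₂.1 (hcov ⟨hva, hvb⟩)
  refine ⟨x, hxT, ?_⟩
  have hx := hT0 x hxT
  obtain ⟨hp1, hp2⟩ := hpts x hx
  have h1 := (hloc x hx v hvx).2 _ hp1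
  have h2 := hp2 v hvx
  have h3 : ‖Φ v - Φ (pts x)‖ ≤ 2 * ‖Φ v - η‖ := by
    have h4 := norm_sub_le (Φ v - η) (Φ (pts x) - η)
    rw [sub_sub_sub_cancel_right] at h4
    linarith
  calc ‖v - pts x‖ ≤ c x * (2 * ‖Φ v - η‖) := h1.trans (by have := hc x; gcongr)
    _ = (c x * 2) * ‖Φ v - η‖ := by ring
    _ ≤ _ := by
      gcongr
      exact Finset.single_le_sum (f := fun x => c x * 2)
        (fun x _ => by have := hc x; positivity) hxT

lemma lower_bound [Nontrivial E] {Φ : E → F} {s : ℝ} (hs1 : 0 < s) (hs : Smo Φ) (hh : Hom s Φ)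
    (hi : ∀ x : E, x ≠ 0 → Function.Injective (fderiv ℝ Φ x)) :
    ∃ c > 0, ∀ x : E, x ≠ 0 → c * ‖x‖ ^ s ≤ ‖Φ x‖ := by
  have hne : ∀ x : E, x ≠ 0 → Φ x ≠ 0 := by
    intro x hx h
    have h1 := hh.euler hs hx
    rw [h, smul_zero, ← map_zero (fderiv ℝ Φ x)] at h1
    exact hx (hi x hx h1)
  have hc : IsCompact (Metric.sphere (0 : E) 1) := isCompact_sphere 0 1
  have hx0 : ∀ x ∈ Metric.sphere (0 : E) 1, x ≠ 0 := fun x hx h => by rw [h] at hx; simp at hx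
  have hcont : ContinuousOn (fun x => ‖Φ x‖) (Metric.sphere (0 : E) 1) := fun x hx =>
    (hs.contDiffAt (hx0 x hx)).continuousAt.norm.continuousWithinAt
  obtain ⟨w, hw, hwm⟩ := hc.exists_isMinOn (NormedSpace.sphere_nonempty.2 zero_le_one) hcont
  refine ⟨‖Φ w‖, norm_pos_iff.2 (hne w (hx0 w hw)), fun x hx => ?_⟩
  have hx' : 0 < ‖x‖ := norm_pos_iff.2 hx
  have hu : ‖‖x‖⁻¹ • x‖ = 1 := by
    rw [norm_smul, norm_inv, norm_norm, inv_mul_cancel₀ hx'.ne']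
  have hu0 : ‖x‖⁻¹ • x ≠ 0 := fun h => by rw [h] at hu; simp at hu
  have h1 := hh ‖x‖ hx' (‖x‖⁻¹ • x) hu0
  rw [smul_smul, mul_inv_cancel₀ hx'.ne', one_smul] at h1
  rw [h1, norm_smul, mul_comm, Real.norm_of_nonneg (by positivity)]
  gcongr
  exact hwm (by simpa using hu)

lemma geo_main [Nontrivial E] {Φ : E → F} {s : ℝ} (hs1 : 1 ≤ s) (hs : Smo Φ) (hh : Hom s Φ)
    (hi : ∀ x : E, x ≠ 0 → Function.Injective (fderiv ℝ Φ x)) :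
    ∃ (T : Finset E) (C : ℝ), 0 ≤ C ∧ ∀ ω : F, ∃ pts : E → E, ∀ u : E, u ≠ 0 →
      ‖u‖ ≤ C * (‖Φ u - ω‖ / ‖u‖ ^ (s - 1)) ∨
      ∃ j ∈ T, ‖u - pts j‖ ≤ C * (‖Φ u - ω‖ / ‖u‖ ^ (s - 1)) := by
  have hs0 : 0 < s := by linarith
  obtain ⟨c₀, hc₀, hlow⟩ := lower_bound hs0 hs hh hi
  obtain ⟨C₀, hC₀, hup⟩ := hh.bound hs
  set a : ℝ := (1 / (C₀ + c₀)) ^ (1 / s) with ha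
  set b : ℝ := (2 / c₀) ^ (1 / s) with hb
  have ha0 : 0 < a := by positivity
  have hb0 : 0 < b := by positivity
  obtain ⟨T, C₁, hC₁, hT⟩ := annulus hs hi a b ha0
  refine ⟨T, 2 / c₀ + C₁ * b ^ (s - 1), by positivity, fun ω => ?_⟩
  set σ : ℝ := ‖ω‖ ^ (1 / s) with hσ
  obtain ⟨pts, hpts⟩ := hT ((σ⁻¹) ^ s • ω)
  refine ⟨fun j => σ • pts j, fun u hu => ?_⟩
  have hu' : 0 < ‖u‖ := norm_pos_iff.2 hu
  have hus : 0 < ‖u‖ ^ s := by positivity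
  have hus1 : 0 < ‖u‖ ^ (s - 1) := by positivity
  have huu : ‖u‖ ^ s = ‖u‖ * ‖u‖ ^ (s - 1) := by
    rw [Real.rpow_sub hu', Real.rpow_one]; field_simp
  by_cases hcase : c₀ / 2 * ‖u‖ ^ s ≤ ‖Φ u - ω‖
  · left
    have h1 : ‖u‖ ≤ 2 / c₀ * (‖Φ u - ω‖ / ‖u‖ ^ (s - 1)) := by
      rw [← mul_div_assoc, le_div_iff₀ hus1, ← huu, div_mul_eq_mul_div, le_div_iff₀ hc₀]
      linarith
    refine h1.trans ?_
    gcongr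
    have : 0 ≤ C₁ * b ^ (s - 1) := by positivity
    linarith
  · right
    push Not at hcase
    have h1 := hlow u hu
    have h2 := hup u hu
    have h3 : c₀ / 2 * ‖u‖ ^ s ≤ ‖ω‖ := by
      have := norm_sub_norm_le (Φ u) ω
      linarith
    have h4 : ‖ω‖ ≤ (C₀ + c₀) * ‖u‖ ^ s := by
      have := norm_sub_norm_le ω (Φ u)
      rw [norm_sub_rev] at this
      nlinarith
    have hω : 0 < ‖ω‖ := lt_of_lt_of_le (by positivity) h3
    have hσ0 : 0 < σ := by positivity
    have hσs : σ ^ s = ‖ω‖ := by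
      rw [hσ, ← Real.rpow_mul hω.le, one_div_mul_cancel hs0.ne', Real.rpow_one]
    have hvn : ‖σ⁻¹ • u‖ = ‖u‖ / σ := by
      rw [norm_smul, norm_inv, Real.norm_of_nonneg hσ0.le]; ring
    have hvs : (‖u‖ / σ) ^ s = ‖u‖ ^ s / ‖ω‖ := by
      rw [Real.div_rpow hu'.le hσ0.le, hσs]
    have hva : a ≤ ‖u‖ / σ := by
      rw [← Real.rpow_le_rpow_iff ha0.le (by positivity) hs0, hvs, ha,
        ← Real.rpow_mul (by positivity), one_div_mul_cancel hs0.ne', Real.rpow_one,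
        div_le_div_iff₀ (by positivity) hω]
      linarith
    have hvb : ‖u‖ / σ ≤ b := by
      rw [← Real.rpow_le_rpow_iff (by positivity) hb0.le hs0, hvs, hb,
        ← Real.rpow_mul (by positivity), one_div_mul_cancel hs0.ne', Real.rpow_one,
        div_le_div_iff₀ hω hc₀]
      linarith
    obtain ⟨j, hj, hjv⟩ := hpts (σ⁻¹ • u) (by rw [hvn]; exact hva) (by rw [hvn]; exact hvb)
    refine ⟨j, hj, ?_⟩
    rw [hh σ⁻¹ (by positivity) u hu, ← smul_sub, norm_smul,
      Real.norm_of_nonneg (by positivity : 0 ≤ σ⁻¹ ^ s)] at hjv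
    have h5 : ‖u - σ • pts j‖ = σ * ‖σ⁻¹ • u - pts j‖ := by
      rw [← Real.norm_of_nonneg hσ0.le, ← norm_smul, Real.norm_of_nonneg hσ0.le, smul_sub, smul_smul,
        mul_inv_cancel₀ hσ0.ne', one_smul]
    have h6 : σ * σ⁻¹ ^ s = (‖u‖ / σ) ^ (s - 1) / ‖u‖ ^ (s - 1) := by
      rw [Real.div_rpow hu'.le hσ0.le, Real.inv_rpow hσ0.le, Real.rpow_sub hσ0, Real.rpow_one]
      field_simp
    calc ‖u - σ • pts j‖ ≤ σ * (C₁ * (σ⁻¹ ^ s * ‖Φ u - ω‖)) := by rw [h5]; gcongr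
      _ = C₁ * ((σ * σ⁻¹ ^ s) * ‖Φ u - ω‖) := by ring
      _ = C₁ * (‖u‖ / σ) ^ (s - 1) * (‖Φ u - ω‖ / ‖u‖ ^ (s - 1)) := by rw [h6]; ring
      _ ≤ C₁ * b ^ (s - 1) * (‖Φ u - ω‖ / ‖u‖ ^ (s - 1)) := by
          gcongr
      _ ≤ _ := by
          gcongr
          have : 0 ≤ 2 / c₀ := by positivity
          linarith
end geo
end SmoothEst

namespace SmoothEst

section sbd
variable {E : Type} [NormedAddCommGroup E] [InnerProductSpace ℝ E] [FiniteDimensional ℝ E]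
  [MeasurableSpace E] [BorelSpace E]

lemma Dm_nonneg (μ : E → ℝ) (t : ℝ) (ζ z : E) : 0 ≤ Dm μ t ζ z := norm_nonneg _

lemma Sm_nonneg (N : ℕ) (μ : E → ℝ) (m t : ℝ) (ζ z : E) : 0 ≤ Sm N μ m t ζ z := by
  have h1 := Dm_nonneg μ t ζ z
  have h2 := one_le_Mm m t z
  unfold Sm
  split_ifs
  · exact zero_le_one
  · positivity

lemma Sm_le_one (N : ℕ) (μ : E → ℝ) (m t : ℝ) (ζ z : E) : Sm N μ m t ζ z ≤ 1 := by
  have h1 := Dm_nonneg μ t ζ z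
  have h2 := one_le_Mm m t z
  unfold Sm
  split_ifs
  · exact le_rfl
  · refine pow_le_one₀ (by positivity) (inv_le_one_of_one_le₀ ?_)
    have : 0 ≤ Dm μ t ζ z / Mm m t z := by positivity
    linarith

lemma Sm_meas (N : ℕ) (μ : E → ℝ) (m t : ℝ) :
    Measurable (fun w : E × E => Sm N μ m t w.1 w.2) := by
  have hD : Measurable (fun w : E × E => Dm μ t w.1 w.2) := by
    unfold Dm
    have h1 : Measurable (fun w : E × E => t • fderiv ℝ μ w.2) :=
      ((measurable_fderiv ℝ μ).comp measurable_snd).const_smul t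
    have h2 : Measurable (fun w : E × E => innerSL ℝ w.1) :=
      ((innerSL ℝ).continuous.measurable).comp measurable_fst
    exact (h1.sub h2).norm
  have hM : Measurable (fun w : E × E => Mm m t w.2) := by
    unfold Mm
    exact measurable_const.max (measurable_const.mul ((measurable_snd.norm).pow_const _))
  unfold Sm
  refine Measurable.ite ?_ measurable_const ?_
  · exact measurableSet_le measurable_snd.norm measurable_const
  · exact ((measurable_const.add (hD.div hM)).inv).pow_const _

lemma Sm_bound [Nontrivial E] {m : ℝ} (hm : 2 ≤ m) {μ : E → ℝ} (hs : Smo μ) (hh : Hom m μ)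
    (hi : ∀ x : E, ‖x‖ = 1 → Function.Injective (fderiv ℝ (fderiv ℝ μ) x)) (N : ℕ) :
    ∃ (T : Finset (Option E)) (C : ℝ), 0 ≤ C ∧ ∀ t ζ, 0 < t → t ≤ 1 →
      ∃ pts : Option E → E, ∀ z : E,
      ∃ j ∈ T, Sm N μ m t ζ z ≤ C * (1 + (t ^ (1 / m)) ^ 2 * ‖z - pts j‖)⁻¹ ^ N := by
  have hΦ := hh.fderiv hs
  have hm0 : 0 < m := by linarith
  obtain ⟨T, C, hC, hT⟩ := geo_main (s := m - 1) (by linarith) hs.fderiv hΦ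
    (fun x hx => hess_inj hs.fderiv hΦ hi hx)
  refine ⟨Finset.insertNone T, (3 + C) ^ N, by positivity, fun t ζ ht ht1 => ?_⟩
  set l : ℝ := t ^ (1 / m) with hl
  have hl0 : 0 < l := by positivity
  have hl1 : l ≤ 1 := Real.rpow_le_one ht.le ht1 (by positivity)
  have hlm : l ^ m = t := by
    rw [hl, ← Real.rpow_mul ht.le, one_div_mul_cancel hm0.ne', Real.rpow_one]
  obtain ⟨pts, hpts⟩ := hT (l⁻¹ • innerSL ℝ ζ)
  refine ⟨fun j => j.elim 0 (fun x => l⁻¹ • pts x), fun z => ?_⟩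
  -- a general comparison
  have comp : ∀ A R : ℝ, 0 ≤ A → 0 ≤ R → 1 + A ≤ (3 + C) * (1 + R) →
      (1 + R)⁻¹ ^ N ≤ (3 + C) ^ N * (1 + A)⁻¹ ^ N := by
    intro A R hA hR h
    rw [← mul_pow]
    gcongr
    rw [← div_eq_mul_inv, inv_eq_one_div, div_le_div_iff₀ (by positivity) (by positivity)]
    linarith
  have hnone : none ∈ Finset.insertNone T := by simp
  by_cases h2 : ‖z‖ ≤ 2
  · refine ⟨none, hnone, (Sm_le_one N μ m t ζ z).trans ?_⟩
    have h3 := comp (l ^ 2 * ‖z - 0‖) 0 (by positivity) le_rfl (by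
      rw [sub_zero]
      have : l ^ 2 * ‖z‖ ≤ 1 * 2 := by
        gcongr
        exact pow_le_one₀ hl0.le hl1
      linarith)
    simpa using h3
  by_cases h3 : ‖l • z‖ ≤ 1
  · refine ⟨none, hnone, (Sm_le_one N μ m t ζ z).trans ?_⟩
    have h4 := comp (l ^ 2 * ‖z - 0‖) 0 (by positivity) le_rfl (by
      rw [sub_zero]
      rw [norm_smul, Real.norm_of_nonneg hl0.le] at h3
      have : l * (l * ‖z‖) ≤ 1 * 1 := by gcongr
      nlinarith)
    simpa using h4
  push Not at h2 h3
  have hz0 : z ≠ 0 := fun h => by rw [h, norm_zero] at h2; linarith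
  have hu0 : l • z ≠ 0 := smul_ne_zero hl0.ne' hz0
  have hun : 0 < ‖l • z‖ := norm_pos_iff.2 hu0
  set R : ℝ := ‖fderiv ℝ μ (l • z) - l⁻¹ • innerSL ℝ ζ‖ / ‖l • z‖ ^ (m - 1 - 1) with hR
  have hR0 : 0 ≤ R := by positivity
  have hD : Dm μ t ζ z = l * ‖fderiv ℝ μ (l • z) - l⁻¹ • innerSL ℝ ζ‖ := by
    unfold Dm
    rw [hΦ l hl0 z hz0, ← Real.norm_of_nonneg hl0.le, ← norm_smul, Real.norm_of_nonneg hl0.le,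
      smul_sub, smul_smul, smul_smul, mul_inv_cancel₀ hl0.ne', one_smul, Real.rpow_sub hl0, hlm,
      Real.rpow_one, mul_div_cancel₀ _ hl0.ne']
  have hM : Mm m t z ≤ ‖l • z‖ ^ (m - 1 - 1) := by
    have h4 : m - 1 - 1 = m - 2 := by ring
    rw [h4]
    unfold Mm
    refine max_le (Real.one_le_rpow h3.le (by linarith)) ?_
    rw [norm_smul, Real.norm_of_nonneg hl0.le, Real.mul_rpow hl0.le (norm_nonneg _),
      Real.rpow_sub hl0, hlm]
    gcongr
    rw [le_div_iff₀ (by positivity)]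
    have : l ^ (2 : ℝ) ≤ 1 := Real.rpow_le_one hl0.le hl1 (by norm_num)
    nlinarith
  have hM1 := one_le_Mm m t z
  have hDM : l * R ≤ Dm μ t ζ z / Mm m t z := by
    rw [hD, hR, ← mul_div_assoc]
    gcongr
  have hSm : Sm N μ m t ζ z ≤ (1 + l * R)⁻¹ ^ N := by
    unfold Sm
    rw [if_neg (not_le.2 h2)]
    have := Dm_nonneg μ t ζ z
    gcongr
  have key : ∀ w : E, ‖l • z - w‖ ≤ C * R →
      Sm N μ m t ζ z ≤ (3 + C) ^ N * (1 + l ^ 2 * ‖z - l⁻¹ • w‖)⁻¹ ^ N := by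
    intro w hw
    refine hSm.trans (comp _ _ (by positivity) (by positivity) ?_)
    have h5 : l ^ 2 * ‖z - l⁻¹ • w‖ = l * ‖l • z - w‖ := by
      have : l • z - w = l • (z - l⁻¹ • w) := by
        rw [smul_sub, smul_smul, mul_inv_cancel₀ hl0.ne', one_smul]
      rw [this, norm_smul, Real.norm_of_nonneg hl0.le]
      ring
    rw [h5]
    have h6 : l * ‖l • z - w‖ ≤ l * (C * R) := by gcongr
    have h7 : 0 ≤ l * R := by positivity
    nlinarith
  rcases hpts (l • z) hu0 with h | ⟨j, hj, h⟩
  · refine ⟨none, hnone, ?_⟩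
    have := key 0 (by rw [sub_zero]; exact h)
    simpa using this
  · exact ⟨some j, by simpa using hj, key _ h⟩

lemma lintegral_scale (f : E → ℝ≥0∞) (hf : Measurable f) {c : ℝ} (hc : 0 < c) (x : E) :
    ∫⁻ z, f (c • (z - x)) = ENNReal.ofReal ((c ^ Module.finrank ℝ E)⁻¹) * ∫⁻ z, f z := by
  rw [lintegral_sub_right_eq_self (fun z => f (c • z)) x]
  have h1 := Measure.map_addHaar_smul (volume : Measure E) hc.ne'
  rw [← lintegral_map hf (measurable_const_smul c), h1, lintegral_smul_measure, smul_eq_mul,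
    abs_of_pos (by positivity)]

lemma Sm_int [Nontrivial E] {m : ℝ} (hm : 2 ≤ m) {μ : E → ℝ} (hs : Smo μ) (hh : Hom m μ)
    (hi : ∀ x : E, ‖x‖ = 1 → Function.Injective (fderiv ℝ (fderiv ℝ μ) x)) :
    ∃ C : ℝ, 0 ≤ C ∧ ∀ t ζ, 0 < t → t ≤ 1 →
      ∫⁻ z, ENNReal.ofReal (Sm (Module.finrank ℝ E + 1) μ m t ζ z) ≤
        ENNReal.ofReal (C * t ^ (-(2 * (Module.finrank ℝ E : ℝ) / m))) := by
  set n := Module.finrank ℝ E with hn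
  obtain ⟨T, C, hC, hT⟩ := Sm_bound hm hs hh hi (n + 1)
  let k : E → ℝ≥0∞ := fun z => ENNReal.ofReal ((1 + ‖z‖)⁻¹ ^ (n + 1))
  have hk : Measurable k := by
    refine ENNReal.measurable_ofReal.comp ?_
    exact ((measurable_const.add measurable_norm).inv).pow_const _
  have hkf : ∫⁻ z, k z ≠ ⊤ := by
    have := finite_integral_one_add_norm (E := E) (μ := volume) (r := (n + 1 : ℕ))
      (by rw [← hn]; push_cast; linarith)
    refine (lt_of_eq_of_lt ?_ this).ne
    congr 1
    funext z
    simp only [k]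
    rw [Real.rpow_neg (by positivity), Real.rpow_natCast, inv_pow]
  refine ⟨T.card * (C * (∫⁻ z, k z).toReal), by positivity, fun t ζ ht ht1 => ?_⟩
  obtain ⟨pts, hpts⟩ := hT t ζ ht ht1
  set l : ℝ := t ^ (1 / m) with hl
  have hl0 : 0 < l := by positivity
  calc ∫⁻ z, ENNReal.ofReal (Sm (n + 1) μ m t ζ z)
      ≤ ∫⁻ z, ∑ j ∈ T, ENNReal.ofReal C * k (l ^ 2 • (z - pts j)) := by
        refine lintegral_mono fun z => ?_
        obtain ⟨j, hj, h⟩ := hpts z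
        refine le_trans ?_ (Finset.single_le_sum
          (f := fun j => ENNReal.ofReal C * k (l ^ 2 • (z - pts j))) (fun _ _ => zero_le) hj)
        simp only [k]
        rw [← ENNReal.ofReal_mul hC, norm_smul, Real.norm_of_nonneg (by positivity : 0 ≤ l ^ 2)]
        exact ENNReal.ofReal_le_ofReal h
    _ = ∑ j ∈ T, ENNReal.ofReal C * (ENNReal.ofReal (((l ^ 2) ^ n)⁻¹) * ∫⁻ z, k z) := by
        rw [lintegral_finsetSum]
        · refine Finset.sum_congr rfl fun j _ => ?_
          rw [lintegral_const_mul, lintegral_scale k hk (by positivity)]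
          exact hk.comp ((measurable_id.sub_const _).const_smul _)
        · intro j _
          exact (hk.comp ((measurable_id.sub_const _).const_smul _)).const_mul _
    _ = ENNReal.ofReal (T.card * (C * (∫⁻ z, k z).toReal) * t ^ (-(2 * (n : ℝ) / m))) := by
        have h1 : ((l ^ 2) ^ n)⁻¹ = t ^ (-(2 * (n : ℝ) / m)) := by
          rw [Real.rpow_neg ht.le, ← pow_mul, hl, ← Real.rpow_natCast, ← Real.rpow_mul ht.le]
          congr 2
          push_cast
          ring
        rw [h1, Finset.sum_const, nsmul_eq_mul, mul_assoc, ENNReal.ofReal_mul (by positivity),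
          mul_assoc, ENNReal.ofReal_mul hC, mul_comm (∫⁻ z, k z).toReal,
          ENNReal.ofReal_mul (by positivity), ENNReal.ofReal_toReal hkf, ENNReal.ofReal_natCast]
    _ ≤ _ := le_rfl

lemma Sm_norm [Nontrivial E] {m : ℝ} (hm : 2 ≤ m) {μ : E → ℝ} (hs : Smo μ) (hh : Hom m μ)
    (hi : ∀ x : E, ‖x‖ = 1 → Function.Injective (fderiv ℝ (fderiv ℝ μ) x)) (p : ℝ≥0∞)
    (hp : 1 ≤ p) :
    ∃ C : ℝ, 0 ≤ C ∧ ∀ t ζ, 0 < t → t ≤ 1 →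
      eLpNorm (fun z => Sm (Module.finrank ℝ E + 1) μ m t ζ z) p volume ≤
        ENNReal.ofReal (C * t ^ (-(2 * (Module.finrank ℝ E : ℝ) / (m * p.toReal)))) := by
  set n := Module.finrank ℝ E with hn
  by_cases hpt : p = ⊤
  · refine ⟨1, zero_le_one, fun t ζ ht ht1 => ?_⟩
    rw [hpt]
    simp only [ENNReal.toReal_top, mul_zero, div_zero, neg_zero, Real.rpow_zero, mul_one]
    rw [eLpNorm_exponent_top]
    refine eLpNormEssSup_le_of_ae_bound (Filter.Eventually.of_forall fun z => ?_)
    rw [Real.norm_of_nonneg (Sm_nonneg _ _ _ _ _ _)]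
    exact Sm_le_one _ _ _ _ _ _
  · obtain ⟨C, hC, hCt⟩ := Sm_int hm hs hh hi
    have hp0 : p ≠ 0 := fun h => by rw [h] at hp; simp at hp
    have hpr : 1 ≤ p.toReal := by
      rw [← ENNReal.toReal_one]; exact ENNReal.toReal_mono hpt hp
    refine ⟨C ^ (1 / p.toReal), by positivity, fun t ζ ht ht1 => ?_⟩
    rw [eLpNorm_eq_lintegral_rpow_enorm_toReal hp0 hpt]
    have h1 : ∫⁻ z, ‖Sm (n + 1) μ m t ζ z‖ₑ ^ p.toReal ≤
        ENNReal.ofReal (C * t ^ (-(2 * (n : ℝ) / m))) := by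
      refine (lintegral_mono fun z => ?_).trans (hCt t ζ ht ht1)
      rw [Real.enorm_of_nonneg (Sm_nonneg _ _ _ _ _ _), ENNReal.ofReal_rpow_of_nonneg
        (Sm_nonneg _ _ _ _ _ _) (by positivity)]
      refine ENNReal.ofReal_le_ofReal ?_
      exact Real.rpow_le_self_of_le_one (Sm_nonneg _ _ _ _ _ _) (Sm_le_one _ _ _ _ _ _) hpr
    refine (ENNReal.rpow_le_rpow h1 (by positivity)).trans ?_
    rw [ENNReal.ofReal_rpow_of_nonneg (by positivity) (by positivity),
      Real.mul_rpow hC (by positivity), ← Real.rpow_mul ht.le]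
    refine ENNReal.ofReal_le_ofReal (le_of_eq ?_)
    congr 2
    field_simp
end sbd
end SmoothEst

namespace SmoothEst

section mink
variable {X Ω : Type} [MeasurableSpace X] [MeasurableSpace Ω]

/-- Minkowski's integral inequality. -/
lemma minkowski (μ : Measure X) [SigmaFinite μ] (ν : Measure Ω) [SFinite ν] (H : X → Ω → ℝ≥0∞)
    (hH : Measurable (Function.uncurry H)) {q : ℝ} (hq : 1 ≤ q) :
    (∫⁻ x, (∫⁻ ω, H x ω ∂ν) ^ q ∂μ) ^ (1 / q) ≤
      ∫⁻ ω, (∫⁻ x, (H x ω) ^ q ∂μ) ^ (1 / q) ∂ν := by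
  rcases hq.eq_or_lt with rfl | hq1
  · simp only [ENNReal.rpow_one, div_one]
    rw [lintegral_lintegral_swap hH.aemeasurable]
  have hq0 : 0 < q := by linarith
  set R := ∫⁻ ω, (∫⁻ x, (H x ω) ^ q ∂μ) ^ (1 / q) ∂ν with hR
  set J : X → ℝ≥0∞ := fun x => ∫⁻ ω, H x ω ∂ν with hJ
  have hJm : Measurable J := hH.lintegral_prod_right
  set B : ℕ → Set X := fun n => spanningSets μ n with hB
  set T : ℕ → X → ℝ≥0∞ := fun n => (B n).indicator (fun x => min (J x) n) with hT
  have hTm : ∀ n, Measurable (T n) := fun n =>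
    (hJm.min measurable_const).indicator (measurableSet_spanningSets μ n)
  have hTJ : ∀ n x, T n x ≤ J x := fun n x =>
    (Set.indicator_le_self _ _ x).trans (min_le_left _ _)
  have hTfin : ∀ n, ∫⁻ x, T n x ^ q ∂μ ≠ ⊤ := by
    intro n
    have h1 : ∫⁻ x, T n x ^ q ∂μ ≤ ∫⁻ x, (B n).indicator (fun _ => (n : ℝ≥0∞) ^ q) x ∂μ := by
      refine lintegral_mono fun x => ?_
      simp only [hT, Set.indicator]
      split_ifs
      · exact ENNReal.rpow_le_rpow (min_le_right _ _) hq0.le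
      · rw [ENNReal.zero_rpow_of_pos hq0]
    rw [lintegral_indicator_const (measurableSet_spanningSets μ n)] at h1
    refine (lt_of_le_of_lt h1 ?_).ne
    exact ENNReal.mul_lt_top (ENNReal.rpow_lt_top_of_nonneg hq0.le (ENNReal.natCast_ne_top n))
      (measure_spanningSets_lt_top μ n)
  have hconj : q.HolderConjugate (q / (q - 1)) := Real.HolderConjugate.conjExponent hq1
  have hstep : ∀ n, (∫⁻ x, T n x ^ q ∂μ) ^ (1 / q) ≤ R := by
    intro n
    set I := ∫⁻ x, T n x ^ q ∂μ with hI
    have h1 : I ≤ R * I ^ (1 / (q / (q - 1))) := by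
      calc I ≤ ∫⁻ x, (∫⁻ ω, H x ω ∂ν) * T n x ^ (q - 1) ∂μ := by
            refine lintegral_mono fun x => ?_
            have : T n x ^ q ≤ T n x * T n x ^ (q - 1) := by
              conv_lhs => rw [show q = 1 + (q - 1) by ring]
              rw [ENNReal.rpow_add_of_nonneg _ _ zero_le_one (by linarith), ENNReal.rpow_one]
            refine this.trans ?_
            gcongr
            exact hTJ n x
        _ = ∫⁻ x, ∫⁻ ω, H x ω * T n x ^ (q - 1) ∂ν ∂μ := by
            congr 1
            funext x
            rw [lintegral_mul_const]
            exact hH.of_uncurry_left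
        _ = ∫⁻ ω, ∫⁻ x, H x ω * T n x ^ (q - 1) ∂μ ∂ν := by
            refine lintegral_lintegral_swap (Measurable.aemeasurable ?_)
            exact hH.mul (((hTm n).comp measurable_fst).pow_const _)
        _ ≤ ∫⁻ ω, (∫⁻ x, (H x ω) ^ q ∂μ) ^ (1 / q) * I ^ (1 / (q / (q - 1))) ∂ν := by
            refine lintegral_mono fun ω => ?_
            have h2 := ENNReal.lintegral_mul_le_Lp_mul_Lq μ hconj (f := fun x => H x ω)
              (g := fun x => T n x ^ (q - 1)) (hH.of_uncurry_right).aemeasurable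
              ((hTm n).pow_const _).aemeasurable
            refine h2.trans (le_of_eq ?_)
            congr 2
            refine lintegral_congr fun x => ?_
            rw [← ENNReal.rpow_mul]
            congr 1
            have : q - 1 ≠ 0 := by linarith
            field_simp
        _ = R * I ^ (1 / (q / (q - 1))) := by
            rw [lintegral_mul_const]
            exact (((hH.pow_const q).lintegral_prod_left)).pow_const _
    by_cases hI0 : I = 0
    · rw [hI0, ENNReal.zero_rpow_of_pos (by positivity)]
      exact zero_le
    · have hexp : 1 / q + 1 / (q / (q - 1)) = 1 := by
        have : q - 1 ≠ 0 := by linarith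
        field_simp
        ring
      have h3 : I = I ^ (1 / q) * I ^ (1 / (q / (q - 1))) := by
        rw [← ENNReal.rpow_add _ _ hI0 (hTfin n), hexp, ENNReal.rpow_one]
      have h4 : I ^ (1 / (q / (q - 1))) ≠ 0 := by
        intro h
        rw [h, mul_zero] at h3
        exact hI0 h3
      have h5 : I ^ (1 / (q / (q - 1))) ≠ ⊤ :=
        ENNReal.rpow_ne_top_of_nonneg (by
          have : 0 < q - 1 := by linarith
          positivity) (hTfin n)
      have h6 : I ^ (1 / q) * I ^ (1 / (q / (q - 1))) ≤ R * I ^ (1 / (q / (q - 1))) := by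
        rw [← h3]; exact h1
      exact (ENNReal.mul_le_mul_iff_left h4 h5).1 h6
  have hmono : Monotone T := by
    intro a b hab x
    simp only [hT]
    refine (Set.indicator_le_indicator_of_subset (monotone_spanningSets μ hab)
      (fun _ => zero_le) x).trans ?_
    refine Set.indicator_le_indicator ?_
    exact min_le_min le_rfl (by exact_mod_cast hab)
  have hsup : ∀ x, ⨆ n, T n x ^ q = J x ^ q := by
    intro x
    refine le_antisymm (iSup_le fun n => ENNReal.rpow_le_rpow (hTJ n x) hq0.le) ?_
    have h1 : ⨆ n, T n x = J x := by
      refine le_antisymm (iSup_le fun n => hTJ n x) ?_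
      refine le_of_forall_lt fun c hc => ?_
      obtain ⟨n1, hn1⟩ := ENNReal.exists_nat_gt (ne_top_of_lt hc)
      set n := max n1 (spanningSetsIndex μ x)
      have hx : x ∈ B n := monotone_spanningSets μ (le_max_right _ _)
        (mem_spanningSetsIndex μ x)
      refine lt_of_lt_of_le ?_ (le_iSup _ n)
      simp only [hT, Set.indicator_of_mem hx]
      refine lt_min hc (hn1.trans_le ?_)
      exact_mod_cast le_max_left _ _
    rw [← h1]
    exact ((ENNReal.orderIsoRpow q hq0).map_iSup (fun n => T n x)).le
  have hlim : ∫⁻ x, J x ^ q ∂μ = ⨆ n, ∫⁻ x, T n x ^ q ∂μ := by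
    rw [← lintegral_iSup (fun n => (hTm n).pow_const q)]
    · exact lintegral_congr fun x => (hsup x).symm
    · intro a b hab x
      exact ENNReal.rpow_le_rpow (hmono hab x) hq0.le
  rw [hlim]
  have := (ENNReal.orderIsoRpow (1 / q) (by positivity)).map_iSup (fun n => ∫⁻ x, T n x ^ q ∂μ)
  have h2 : (⨆ n, ∫⁻ x, T n x ^ q ∂μ) ^ (1 / q) = ⨆ n, (∫⁻ x, T n x ^ q ∂μ) ^ (1 / q) := this
  rw [h2]
  exact iSup_le hstep
end mink
end SmoothEst

namespace SmoothEst

section asm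
variable {E : Type} [NormedAddCommGroup E] [InnerProductSpace ℝ E] [FiniteDimensional ℝ E]
  [MeasurableSpace E] [BorelSpace E]

lemma eLpNorm_translate {F : Type} [NormedAddCommGroup F] (f : E → F) (hf : StronglyMeasurable f)
    (p : ℝ≥0∞) (a : E) : eLpNorm (fun x => f (x + a)) p volume = eLpNorm f p volume :=
  eLpNorm_comp_measurePreserving hf.aestronglyMeasurable (measurePreserving_add_right volume a)

lemma assembly (k : E → ℝ≥0∞) (hk : Measurable k) (G : E → E → ℂ)
    (hG : StronglyMeasurable (Function.uncurry G)) (S : E → E → ℝ)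
    (hS : StronglyMeasurable (Function.uncurry S)) (p' q r : ℝ≥0∞) [ENNReal.HolderTriple p' r q]
    (hq : 1 ≤ q) (hKt : ∫⁻ a, k a ≠ ⊤) (B : ℝ≥0∞) (hBt : B ≠ ⊤)
    (hB : ∀ ζ, eLpNorm (S ζ) p' volume ≤ B) (C : ℝ≥0∞) (ξ : E)
    (f : E → ℂ) (hf : ∀ x, ‖f x‖ₑ ≤ C * ∫⁻ η, ∫⁻ z, ∫⁻ x',
      ‖G η x'‖ₑ * k (z - x') * k (z - x) * ‖S (ξ - η) z‖ₑ) :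
    eLpNorm f q volume ≤ C * (((∫⁻ a, k a) * (∫⁻ a, k a) * B) *
      ∫⁻ η, eLpNorm (G η) r volume) := by
  set K := ∫⁻ a, k a with hK
  have hGs : ∀ η, StronglyMeasurable (G η) := fun η => hG.of_uncurry_left
  have hSs : ∀ η, StronglyMeasurable (S η) := fun η => hS.of_uncurry_left
  have hKKB : K * K * B ≠ ⊤ := ENNReal.mul_ne_top (ENNReal.mul_ne_top hKt hKt) hBt
  by_cases hqt : q = ⊤
  · subst hqt
    have h1 : p'⁻¹ + r⁻¹ = 0 := by
      have := ENNReal.HolderTriple.inv_add_inv_eq_inv p' r ⊤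
      simpa using this
    have hp' : p' = ⊤ := by
      have := (add_eq_zero.1 h1).1
      simpa using this
    have hr : r = ⊤ := by
      have := (add_eq_zero.1 h1).2
      simpa using this
    subst hp' hr
    rw [eLpNorm_exponent_top]
    refine essSup_le_of_ae_le _ (Filter.Eventually.of_forall fun x => ?_)
    refine (hf x).trans ?_
    refine mul_le_mul' le_rfl ?_
    rw [← lintegral_const_mul' _ _ hKKB]
    refine lintegral_mono fun η => ?_
    have hSz : ∀ᵐ z, ‖S (ξ - η) z‖ₑ ≤ B := by
      have h2 := hB (ξ - η)
      rw [eLpNorm_exponent_top] at h2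
      filter_upwards [enorm_ae_le_eLpNormEssSup (S (ξ - η)) volume] with z hz
      exact hz.trans h2
    have hGx : ∀ᵐ x', ‖G η x'‖ₑ ≤ eLpNorm (G η) ⊤ volume := by
      rw [eLpNorm_exponent_top]
      exact enorm_ae_le_eLpNormEssSup (G η) volume
    set M := eLpNorm (G η) ⊤ volume
    calc ∫⁻ z, ∫⁻ x', ‖G η x'‖ₑ * k (z - x') * k (z - x) * ‖S (ξ - η) z‖ₑ
        ≤ ∫⁻ z, k (z - x) * (K * B * M) := by
          refine lintegral_mono_ae ?_
          filter_upwards [hSz] with z hz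
          calc ∫⁻ x', ‖G η x'‖ₑ * k (z - x') * k (z - x) * ‖S (ξ - η) z‖ₑ
              ≤ ∫⁻ x', k (z - x') * (M * k (z - x) * B) := by
                refine lintegral_mono_ae ?_
                filter_upwards [hGx] with x' hx'
                calc ‖G η x'‖ₑ * k (z - x') * k (z - x) * ‖S (ξ - η) z‖ₑ
                    ≤ M * k (z - x') * k (z - x) * B := by gcongr
                  _ = _ := by ring
            _ = K * (M * k (z - x) * B) := by
                have hmm : Measurable (fun x' => k (z - x')) := by fun_prop
                rw [lintegral_mul_const _ hmm, lintegral_sub_left_eq_self (fun y => k y) z]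
            _ = _ := by ring
      _ = K * (K * B * M) := by
          have hmm : Measurable (fun z => k (z - x)) := by fun_prop
          rw [lintegral_mul_const _ hmm, lintegral_sub_right_eq_self (fun y => k y) x]
      _ = _ := by ring
  have hq0 : q ≠ 0 := fun h => by rw [h] at hq; simp at hq
  have hqr : 1 ≤ q.toReal := by
    rw [← ENNReal.toReal_one]; exact ENNReal.toReal_mono hqt hq
  set Q := q.toReal with hQ
  have hQ0 : 0 < Q := by linarith
  let H : E → E × E × E → ℝ≥0∞ := fun x ω =>
    (k ω.2.2 * k ω.2.1) * ‖S (ξ - ω.1) (x + ω.2.1) • G ω.1 (x + ω.2.1 - ω.2.2)‖ₑ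
  have hH : Measurable (Function.uncurry H) := by
    have e1 : Measurable (fun w : E × E × E × E => ‖S (ξ - w.2.1) (w.1 + w.2.2.1)‖ₑ) := by
      refine Measurable.enorm (hS.measurable.comp (g := Function.uncurry S)
        (f := fun w : E × E × E × E => (ξ - w.2.1, w.1 + w.2.2.1)) ?_)
      fun_prop
    have e2 : Measurable (fun w : E × E × E × E => ‖G (w.2.1) (w.1 + w.2.2.1 - w.2.2.2)‖ₑ) := by
      refine Measurable.enorm (hG.measurable.comp (g := Function.uncurry G)
        (f := fun w : E × E × E × E => (w.2.1, w.1 + w.2.2.1 - w.2.2.2)) ?_)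
      fun_prop
    have e3 : Measurable (fun w : E × E × E × E => k w.2.2.2 * k w.2.2.1) := by fun_prop
    have e4 := e3.mul (e1.mul e2)
    convert e4 using 1
    funext w
    simp only [Function.uncurry, H, enorm_smul, Pi.mul_apply]
  have hrew : ∀ x, ∫⁻ η, ∫⁻ z, ∫⁻ x', ‖G η x'‖ₑ * k (z - x') * k (z - x) * ‖S (ξ - η) z‖ₑ =
      ∫⁻ ω, H x ω := by
    intro x
    rw [Measure.volume_eq_prod, lintegral_prod _ (hH.of_uncurry_left).aemeasurable]
    refine lintegral_congr fun η => ?_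
    rw [Measure.volume_eq_prod, lintegral_prod]
    · rw [← lintegral_add_left_eq_self _ x]
      refine lintegral_congr fun b => ?_
      rw [← lintegral_sub_left_eq_self _ (x + b)]
      refine lintegral_congr fun a => ?_
      simp only [H, enorm_smul, sub_sub_cancel, add_sub_cancel_left]
      ring
    · exact ((hH.of_uncurry_left (x := x)).comp (measurable_prodMk_left)).aemeasurable
  simp_rw [hrew] at hf
  have hω : ∀ ω : E × E × E, (∫⁻ x, (H x ω) ^ Q) ^ (1 / Q) ≤
      k ω.2.2 * (k ω.2.1 * (B * eLpNorm (G ω.1) r volume)) := by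
    rintro ⟨η, b, a⟩
    set c := k a * k b with hc
    have hT : ∀ x, H x (η, b, a) = c * ‖S (ξ - η) (x + b) • G η (x + b - a)‖ₑ := fun x => rfl
    have hGa : (fun x => G η (x + b - a)) = fun x => G η (x + (b - a)) := by
      funext x; rw [add_sub_assoc]
    have hm1 : StronglyMeasurable (fun x => S (ξ - η) (x + b)) :=
      (hSs (ξ - η)).comp_measurable (measurable_id.add_const b)
    have hm2 : StronglyMeasurable (fun x => G η (x + b - a)) := by
      rw [hGa]; exact (hGs η).comp_measurable (measurable_id.add_const _)
    have h1 : (∫⁻ x, (H x (η, b, a)) ^ Q) ^ (1 / Q) =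
        c * eLpNorm (fun x => S (ξ - η) (x + b) • G η (x + b - a)) q volume := by
      rw [eLpNorm_eq_lintegral_rpow_enorm_toReal hq0 hqt]
      simp_rw [hT, ENNReal.mul_rpow_of_nonneg _ _ hQ0.le]
      have hm3 : Measurable (fun x => ‖S (ξ - η) (x + b) • G η (x + b - a)‖ₑ ^ Q) :=
        (hm1.smul hm2).measurable.enorm.pow_const _
      rw [lintegral_const_mul _ hm3,
        ENNReal.mul_rpow_of_nonneg _ _ (by positivity), ← ENNReal.rpow_mul,
        mul_one_div_cancel hQ0.ne', ENNReal.rpow_one]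
    have h2 : eLpNorm (fun x => S (ξ - η) (x + b) • G η (x + b - a)) q volume ≤
        eLpNorm (fun x => S (ξ - η) (x + b)) p' volume *
        eLpNorm (fun x => G η (x + b - a)) r volume :=
      eLpNorm_smul_le_mul_eLpNorm (f := fun x => G η (x + b - a))
        (φ := fun x => S (ξ - η) (x + b)) hm2.aestronglyMeasurable hm1.aestronglyMeasurable
    rw [eLpNorm_translate _ (hSs _), hGa, eLpNorm_translate _ (hGs _)] at h2
    rw [h1]
    calc _ ≤ c * (B * eLpNorm (G η) r volume) := by
          refine mul_le_mul' le_rfl (h2.trans ?_)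
          gcongr
          exact hB _
      _ = _ := by rw [hc]; ring
  rw [eLpNorm_eq_lintegral_rpow_enorm_toReal hq0 hqt]
  calc (∫⁻ x, ‖f x‖ₑ ^ Q) ^ (1 / Q)
      ≤ (∫⁻ x, (C * ∫⁻ ω, H x ω) ^ Q) ^ (1 / Q) := by
        refine ENNReal.rpow_le_rpow (lintegral_mono fun x => ?_) (by positivity)
        exact ENNReal.rpow_le_rpow (hf x) hQ0.le
    _ = C * (∫⁻ x, (∫⁻ ω, H x ω) ^ Q) ^ (1 / Q) := by
        simp_rw [ENNReal.mul_rpow_of_nonneg _ _ hQ0.le]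
        rw [lintegral_const_mul _ (hH.lintegral_prod_right.pow_const _),
          ENNReal.mul_rpow_of_nonneg _ _ (by positivity), ← ENNReal.rpow_mul,
          mul_one_div_cancel hQ0.ne', ENNReal.rpow_one]
    _ ≤ C * ∫⁻ ω, (∫⁻ x, (H x ω) ^ Q) ^ (1 / Q) :=
        mul_le_mul' le_rfl (minkowski volume volume H hH hqr)
    _ ≤ _ := by
        refine mul_le_mul' le_rfl ?_
        have hm : Measurable (fun ω => (∫⁻ x, (H x ω) ^ Q) ^ (1 / Q)) :=
          ((hH.pow_const Q).lintegral_prod_left).pow_const _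
        rw [Measure.volume_eq_prod, lintegral_prod _ hm.aemeasurable,
          ← lintegral_const_mul' _ _ hKKB]
        refine lintegral_mono fun η => ?_
        have hm4 : Measurable (fun y : E × E => (∫⁻ x, (H x (η, y)) ^ Q) ^ (1 / Q)) :=
          hm.comp measurable_prodMk_left
        rw [Measure.volume_eq_prod, lintegral_prod _ hm4.aemeasurable]
        calc _ ≤ ∫⁻ b, ∫⁻ a, k a * (k b * (B * eLpNorm (G η) r volume)) :=
              lintegral_mono fun b => lintegral_mono fun a => hω (η, b, a)
          _ = _ := by
              simp_rw [lintegral_mul_const _ hk]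
              rw [lintegral_const_mul _ (hk.mul_const _), lintegral_mul_const _ hk]
              ring
end asm
end SmoothEst

namespace SmoothEst

section rep
variable {E : Type} [NormedAddCommGroup E] [InnerProductSpace ℝ E] [FiniteDimensional ℝ E]
  [MeasurableSpace E] [BorelSpace E]

lemma fub (f w : E → ℂ) (hf : Integrable f) (hw : Integrable w) :
    ∫ z, ∫ y, f y * w (y - z) = (∫ y, f y) * ∫ v, w v := by
  have h1 : Integrable (fun p : E × E => f p.2 * w (p.2 - p.1)) (volume.prod volume) := by
    have := Integrable.convolution_integrand (ContinuousLinearMap.mul ℝ ℂ) hf hw.comp_neg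
    simpa using this
  rw [integral_integral_swap h1, ← integral_mul_const]
  congr 1
  funext y
  rw [integral_const_mul, integral_sub_left_eq_self w volume y]

lemma four_pair (u : SchwartzMap E ℂ) (b : E → ℂ) (hb : Integrable b) :
    ∫ y, u y * b y = ∫ η, (∫ y, cexp (-(((2 * π * ⟪η, y⟫ : ℝ) : ℂ) * I)) * u y) *
      (∫ y, cexp (((2 * π * ⟪η, y⟫ : ℝ) : ℂ) * I) * b y) := by
  have h1 : ∀ η, (FourierTransform.fourier u) η =
      ∫ y, cexp (-(((2 * π * ⟪η, y⟫ : ℝ) : ℂ) * I)) * u y := by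
    intro η
    rw [SchwartzMap.fourier_coe, Real.fourier_eq']
    congr 1
    funext y
    rw [smul_eq_mul, real_inner_comm]
    congr 2
    push_cast; ring
  have h2 : ∀ η, FourierTransformInv.fourierInv b η =
      ∫ y, cexp (((2 * π * ⟪η, y⟫ : ℝ) : ℂ) * I) * b y := by
    intro η
    rw [Real.fourierInv_eq']
    congr 1
    funext y
    rw [smul_eq_mul, real_inner_comm]
  have h3 : ∀ y, u y = FourierTransformInv.fourierInv
      (FourierTransform.fourier u : SchwartzMap E ℂ) y := by
    intro y
    rw [FourierTransform.fourierInv_fourier_eq]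
  simp_rw [← h1, ← h2]
  have h6 : ∫ y, u y * b y = ∫ y, FourierTransformInv.fourierInv
      (FourierTransform.fourier u : SchwartzMap E ℂ) y * b y := by simp_rw [h3]
  have hc : Continuous fun p : E × E => (-innerₗ E) p.1 p.2 := by
    have h0 : Continuous fun p : E × E => -⟪p.1, p.2⟫ := by fun_prop
    simpa using! h0
  have h4 := VectorFourier.integral_fourierIntegral_smul_eq_flip (L := -innerₗ E)
      (μ := volume) (ν := volume)
      Real.continuous_fourierChar hc
      (FourierTransform.fourier u : SchwartzMap E ℂ).integrable hb
  have h5 : (-innerₗ E).flip = -innerₗ E := by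
    ext a b; simp [real_inner_comm]
  rw [h5] at h4
  rw [h6, SchwartzMap.fourierInv_coe]
  exact h4

lemma prodS (h g : SchwartzMap E ℂ) (a : E) :
    ∃ u : SchwartzMap E ℂ, ∀ y, u y = h y * (starRingEnd ℂ) (g (y - a)) := by
  refine ⟨SchwartzMap.pairing (ContinuousLinearMap.mul ℝ ℂ) h
    (SchwartzMap.postcompCLM (𝕜 := ℝ) (Complex.conjCLE : ℂ →L[ℝ] ℂ)
      (g.compSubConstCLM ℝ a)), fun y => ?_⟩
  simp

lemma meas_mu {μ : E → ℝ} (hs : Smo μ) : Measurable μ :=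
  measurable_of_continuousOn_compl_singleton 0 hs.continuousOn

lemma norm_one_mul_int (a f : E → ℂ) (ha : Measurable a) (hn : ∀ y, ‖a y‖ ≤ 1)
    (hf : Integrable f) : Integrable (fun y => a y * f y) :=
  hf.bdd_mul ha.aestronglyMeasurable (Filter.Eventually.of_forall hn)

lemma int_gg (g : SchwartzMap E ℂ) (x x' : E) :
    Integrable (fun y => g (y - x') * (starRingEnd ℂ) (g (y - x))) := by
  obtain ⟨u, hu⟩ := prodS (g.compSubConstCLM ℝ x') g x
  refine u.integrable.congr (Filter.Eventually.of_forall fun y => ?_)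
  simp [hu]

lemma meas_osc {μ : E → ℝ} (hs : Smo μ) (t : ℝ) (ζ : E) :
    Measurable (fun y => cexp (((2 * π * (t * μ y - ⟪ζ, y⟫) : ℝ) : ℂ) * I)) := by
  have := meas_mu hs
  have h2 : Measurable (fun y : E => ⟪ζ, y⟫) := (by fun_prop : Continuous fun y : E => ⟪ζ, y⟫).measurable
  fun_prop

lemma bump : ∃ χ : SchwartzMap E ℂ,
    (∀ y ∉ Metric.closedBall (0 : E) (1 / 2), χ y = 0) ∧ ∫ y, χ y = 1 := by
  let φ : ContDiffBump (0 : E) := ⟨1 / 4, 1 / 2, by norm_num, by norm_num⟩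
  have hc : HasCompactSupport (fun y => ((φ.normed volume y : ℝ) : ℂ)) :=
    (φ.hasCompactSupport_normed).comp_left (g := fun r : ℝ => (r : ℂ)) (by simp)
  have hd : ContDiff ℝ (⊤ : ℕ∞) (fun y => ((φ.normed volume y : ℝ) : ℂ)) :=
    Complex.ofRealCLM.contDiff.comp φ.contDiff_normed
  refine ⟨hc.toSchwartzMap hd, fun y hy => ?_, ?_⟩
  · have : φ.normed volume y = 0 := by
      by_contra h0
      have h1 : y ∈ tsupport (φ.normed volume) := subset_tsupport _ h0
      rw [φ.tsupport_normed_eq] at h1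
      exact hy h1
    simp [this]
  · have : ∫ y, ((φ.normed volume y : ℝ) : ℂ) = 1 := by
      rw [integral_complex_ofReal, φ.integral_normed]; simp
    simpa using this

lemma ker_bound {m : ℝ} (hm : 2 ≤ m) {μ : E → ℝ} (hs : Smo μ) (hh : Hom m μ) (N : ℕ)
    (g : SchwartzMap E ℂ) : ∃ C : ℝ, 0 ≤ C ∧ ∀ t ζ x x', 0 < t → t ≤ 1 →
      ‖∫ y, cexp (((2 * π * (t * μ y - ⟪ζ, y⟫) : ℝ) : ℂ) * I) *
        (g (y - x') * (starRingEnd ℂ) (g (y - x)))‖ₑ ≤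
      ENNReal.ofReal C * ∫⁻ z, ENNReal.ofReal (wt N (z - x'))⁻¹ *
        ENNReal.ofReal (wt N (z - x))⁻¹ * ‖Sm N μ m t ζ z‖ₑ := by
  obtain ⟨χ, hχ, hχ1⟩ := bump (E := E)
  obtain ⟨C, hC, hb⟩ := local_est hm hs hh N g χ hχ
  refine ⟨C, hC, fun t ζ x x' ht ht1 => ?_⟩
  set b : E → ℂ := fun y => cexp (((2 * π * (t * μ y - ⟪ζ, y⟫) : ℝ) : ℂ) * I) *
        (g (y - x') * (starRingEnd ℂ) (g (y - x))) with hbdef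
  have hbi : Integrable b := norm_one_mul_int _ _ (meas_osc hs t ζ)
    (fun y => by rw [Complex.norm_exp_ofReal_mul_I]) (int_gg g x x')
  have h1 := fub b χ hbi χ.integrable
  rw [hχ1, mul_one] at h1
  rw [← h1]
  refine (enorm_integral_le_lintegral_enorm _).trans ?_
  rw [← lintegral_const_mul' _ _ ENNReal.ofReal_ne_top]
  refine lintegral_mono fun z => ?_
  have h2 := hb t ζ x x' z ht ht1
  have h3 : ∫ y, b y * χ (y - z) = ∫ y, cexp (((2 * π * (t * μ y - ⟪ζ, y⟫) : ℝ) : ℂ) * I) *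
        (g (y - x') * (starRingEnd ℂ) (g (y - x)) * χ (y - z)) := by
    congr 1; funext y; simp only [hbdef]; ring
  rw [h3, ← ofReal_norm, Real.enorm_eq_ofReal (Sm_nonneg ..),
    ← ENNReal.ofReal_mul (inv_nonneg.2 (wt_pos _ _).le),
    ← ENNReal.ofReal_mul (mul_nonneg (inv_nonneg.2 (wt_pos _ _).le) (inv_nonneg.2 (wt_pos _ _).le)),
    ← ENNReal.ofReal_mul hC]
  exact ENNReal.ofReal_le_ofReal h2

/-- The Gabor transform of `h` with window `g`, frequency variable first. -/
def Gab (g h : SchwartzMap E ℂ) (η x : E) : ℂ :=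
  ∫ y, cexp (-(((2 * π * ⟪η, y⟫ : ℝ) : ℂ) * I)) * h y * (starRingEnd ℂ) (g (y - x))

lemma Gab_meas (g h : SchwartzMap E ℂ) : StronglyMeasurable (Function.uncurry (Gab g h)) := by
  have hg := g.continuous
  have hh := h.continuous
  have hc : Continuous (fun w : (E × E) × E =>
      cexp (-(((2 * π * ⟪w.1.1, w.2⟫ : ℝ) : ℂ) * I)) * h w.2 *
        (starRingEnd ℂ) (g (w.2 - w.1.2))) := by
    have h1 : Continuous fun w : (E × E) × E => (starRingEnd ℂ) (g (w.2 - w.1.2)) :=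
      Complex.continuous_conj.comp (hg.comp (by fun_prop))
    have h2 : Continuous fun w : (E × E) × E => ⟪w.1.1, w.2⟫ := by fun_prop
    fun_prop
  exact hc.stronglyMeasurable.integral_prod_right

lemma rep_bound [Nontrivial E] {m : ℝ} (hm : 2 ≤ m) {μ : E → ℝ} (hs : Smo μ) (hh : Hom m μ)
    (N : ℕ) (F : ℝ → E → ℂ)
    (hF : ∀ t y, y ≠ 0 → F t y = cexp (((2 * π * (t * μ y) : ℝ) : ℂ) * I))
    (g : SchwartzMap E ℂ) (hg : g ≠ 0) :
    ∃ C : ℝ, 0 ≤ C ∧ ∀ t, 0 < t → t ≤ 1 → ∀ (h : SchwartzMap E ℂ) (ξ x : E),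
      ‖∫ y, cexp (-(((2 * π * ⟪ξ, y⟫ : ℝ) : ℂ) * I)) * (F t y * h y) *
        (starRingEnd ℂ) (g (y - x))‖ₑ ≤ ENNReal.ofReal C * ∫⁻ η, ∫⁻ z, ∫⁻ x',
          ‖Gab g h η x'‖ₑ * ENNReal.ofReal (wt N (z - x'))⁻¹ *
            ENNReal.ofReal (wt N (z - x))⁻¹ * ‖Sm N μ m t (ξ - η) z‖ₑ := by
  obtain ⟨C, hC, hK⟩ := ker_bound hm hs hh N g
  -- the L2 mass of the window
  set w : E → ℂ := fun v => (starRingEnd ℂ) (g v) * g v with hw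
  have hwi : Integrable w := by
    have := int_gg g 0 0
    simp only [sub_zero] at this
    simpa [hw, mul_comm] using this
  set c : ℝ := ∫ v, ‖g v‖ ^ 2 with hc
  have hwc : ∫ v, w v = (c : ℂ) := by
    rw [hc, ← integral_complex_ofReal]
    congr 1; funext v
    simp only [hw]
    rw [← Complex.normSq_eq_conj_mul_self, Complex.normSq_eq_norm_sq]
  have hc0 : 0 < c := by
    have hi : Integrable (fun v => ‖g v‖ ^ 2) := by
      have := hwi.norm
      refine this.congr (Filter.Eventually.of_forall fun v => ?_)
      simp [hw, sq]
    obtain ⟨v0, hv0⟩ : ∃ v, g v ≠ 0 := by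
      by_contra hcon
      push Not at hcon
      exact hg (by ext v; simp [hcon v])
    refine integral_pos_of_integrable_nonneg_nonzero (x := v0) (by fun_prop) hi
      (fun v => by positivity) ?_
    simpa using hv0
  refine ⟨C / c, by positivity, fun t ht ht1 h ξ x => ?_⟩
  set k : E → ℝ≥0∞ := fun v => ENNReal.ofReal (wt N v)⁻¹ with hk
  have hkm : Measurable k := by
    have : Measurable (fun v : E => (wt N v)⁻¹) := by
      unfold wt
      exact ((measurable_const.add measurable_norm).pow_const N).inv
    exact ENNReal.measurable_ofReal.comp this
  set f' : E → ℂ := fun y => cexp (((2 * π * (t * μ y - ⟪ξ, y⟫) : ℝ) : ℂ) * I) *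
    (h y * (starRingEnd ℂ) (g (y - x))) with hf'
  have hff : ∫ y, cexp (-(((2 * π * ⟪ξ, y⟫ : ℝ) : ℂ) * I)) * (F t y * h y) *
        (starRingEnd ℂ) (g (y - x)) = ∫ y, f' y := by
    refine integral_congr_ae ?_
    have h0 : ∀ᵐ y : E, y ≠ 0 := by
      simp [ae_iff]
    filter_upwards [h0] with y hy
    rw [hF t y hy]
    simp only [hf']
    have he : cexp (((2 * π * (t * μ y - ⟪ξ, y⟫) : ℝ) : ℂ) * I) =
        cexp (-(((2 * π * ⟪ξ, y⟫ : ℝ) : ℂ) * I)) * cexp (((2 * π * (t * μ y) : ℝ) : ℂ) * I) := by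
      rw [← Complex.exp_add]
      congr 1
      push_cast; ring
    rw [he]; ring
  rw [hff]
  have hf'i : Integrable f' := by
    obtain ⟨u, hu⟩ := prodS h g x
    refine norm_one_mul_int _ _ (meas_osc hs t ξ)
      (fun y => by rw [Complex.norm_exp_ofReal_mul_I]) ?_
    exact u.integrable.congr (Filter.Eventually.of_forall fun y => by simp [hu])
  have h1 := fub f' w hf'i hwi
  rw [hwc] at h1
  have hx' : ∀ x', ‖∫ y, f' y * w (y - x')‖ₑ ≤ ENNReal.ofReal C * ∫⁻ η, ∫⁻ z,
      ‖Gab g h η x'‖ₑ * k (z - x') * k (z - x) * ‖Sm N μ m t (ξ - η) z‖ₑ := by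
    intro x'
    obtain ⟨u, hu⟩ := prodS h g x'
    set b : E → ℂ := fun y => cexp (((2 * π * (t * μ y - ⟪ξ, y⟫) : ℝ) : ℂ) * I) *
        (g (y - x') * (starRingEnd ℂ) (g (y - x))) with hb
    have hbi : Integrable b := norm_one_mul_int _ _ (meas_osc hs t ξ)
      (fun y => by rw [Complex.norm_exp_ofReal_mul_I]) (int_gg g x x')
    have e1 : ∫ y, f' y * w (y - x') = ∫ y, u y * b y := by
      congr 1; funext y
      simp only [hf', hw, hb, hu]; ring
    rw [e1, four_pair u b hbi]
    refine (enorm_integral_le_lintegral_enorm _).trans ?_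
    rw [← lintegral_const_mul' _ _ ENNReal.ofReal_ne_top]
    refine lintegral_mono fun η => ?_
    have e2 : ∫ y, cexp (-(((2 * π * ⟪η, y⟫ : ℝ) : ℂ) * I)) * u y = Gab g h η x' := by
      unfold Gab
      congr 1; funext y
      rw [hu]; ring
    have e3 : ∫ y, cexp (((2 * π * ⟪η, y⟫ : ℝ) : ℂ) * I) * b y =
        ∫ y, cexp (((2 * π * (t * μ y - ⟪ξ - η, y⟫) : ℝ) : ℂ) * I) *
        (g (y - x') * (starRingEnd ℂ) (g (y - x))) := by
      congr 1; funext y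
      simp only [hb]
      rw [← mul_assoc, ← Complex.exp_add, inner_sub_left]
      congr 2
      push_cast; ring
    simp only [e2, e3, enorm_mul]
    refine (mul_le_mul' le_rfl (hK t (ξ - η) x x' ht ht1)).trans ?_
    rw [mul_left_comm, ← lintegral_const_mul' _ _ enorm_ne_top]
    refine mul_le_mul' le_rfl (le_of_eq ?_)
    congr 1; funext z
    simp only [hk]; ring
  have hGm : Measurable (fun v : E × E => ‖Gab g h v.1 v.2‖ₑ) := (Gab_meas g h).measurable.enorm
  have hSm : Measurable (fun v : E × E => ‖Sm N μ m t v.1 v.2‖ₑ) := (Sm_meas N μ m t).enorm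
  have hΦ : Measurable (fun v : (E × E) × E =>
      ‖Gab g h v.1.2 v.1.1‖ₑ * k (v.2 - v.1.1) * k (v.2 - x) * ‖Sm N μ m t (ξ - v.1.2) v.2‖ₑ) := by
    have a1 : Measurable (fun v : (E × E) × E => ‖Gab g h v.1.2 v.1.1‖ₑ) :=
      hGm.comp (g := fun v : E × E => ‖Gab g h v.1 v.2‖ₑ)
        (f := fun v : (E × E) × E => (v.1.2, v.1.1)) (by fun_prop)
    have a2 : Measurable (fun v : (E × E) × E => ‖Sm N μ m t (ξ - v.1.2) v.2‖ₑ) :=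
      hSm.comp (g := fun v : E × E => ‖Sm N μ m t v.1 v.2‖ₑ)
        (f := fun v : (E × E) × E => (ξ - v.1.2, v.2)) (by fun_prop)
    have a3 : Measurable (fun v : (E × E) × E => k (v.2 - v.1.1)) := by fun_prop
    have a4 : Measurable (fun v : (E × E) × E => k (v.2 - x)) := by fun_prop
    exact ((a1.mul a3).mul a4).mul a2
  set T := ∫⁻ η, ∫⁻ z, ∫⁻ x',
          ‖Gab g h η x'‖ₑ * k (z - x') * k (z - x) * ‖Sm N μ m t (ξ - η) z‖ₑ with hT
  have hTT : ∫⁻ x', ∫⁻ η, ∫⁻ z,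
      ‖Gab g h η x'‖ₑ * k (z - x') * k (z - x) * ‖Sm N μ m t (ξ - η) z‖ₑ = T := by
    rw [lintegral_lintegral_swap (hΦ.lintegral_prod_right'.aemeasurable), hT]
    refine lintegral_congr fun η => ?_
    rw [lintegral_lintegral_swap]
    have : Measurable (fun v : E × E => (((v.1, η), v.2) : (E × E) × E)) := by fun_prop
    exact (hΦ.comp this).aemeasurable
  have h2 : ‖∫ y, f' y‖ₑ * ENNReal.ofReal c ≤ ENNReal.ofReal C * T := by
    have : ‖∫ y, f' y‖ₑ * ENNReal.ofReal c = ‖(∫ y, f' y) * (c : ℂ)‖ₑ := by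
      rw [enorm_mul, ← ofReal_norm (c : ℂ), Complex.norm_real, Real.norm_of_nonneg hc0.le]
    rw [this, ← h1]
    refine (enorm_integral_le_lintegral_enorm _).trans ?_
    refine (lintegral_mono hx').trans ?_
    rw [lintegral_const_mul' _ _ ENNReal.ofReal_ne_top, hTT]
  have hcc : ENNReal.ofReal c * ENNReal.ofReal c⁻¹ = 1 := by
    rw [← ENNReal.ofReal_mul hc0.le, mul_inv_cancel₀ hc0.ne', ENNReal.ofReal_one]
  calc ‖∫ y, f' y‖ₑ = (‖∫ y, f' y‖ₑ * ENNReal.ofReal c) * ENNReal.ofReal c⁻¹ := by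
        rw [mul_assoc, hcc, mul_one]
    _ ≤ (ENNReal.ofReal C * T) * ENNReal.ofReal c⁻¹ := mul_le_mul' h2 le_rfl
    _ = ENNReal.ofReal (C / c) * T := by
        rw [div_eq_mul_inv, ENNReal.ofReal_mul hC]; ring
end rep
end SmoothEst

/-- Under hypotheses (H), the smoothing estimate
`‖e^{2πitμ(D)} f‖_{W^{q,∞}} ≲ t^{-2d/(mp')} ‖f‖_{W^{r,1}}` for `0 < t ≤ 1`, written on the
Fourier-transform side: for exponents `1 ≤ p ≤ ∞` with conjugate `p'`, `1 ≤ q ≤ p'` and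
`1/p + 1/q = 1 + 1/r`, and Schwartz `h`,
`sup_ξ ‖V_g(F_{tμ}·h)(·,ξ)‖_{L^q} ≤ C t^{-2d/(mp')} ∫ ‖V_g h(·,ξ')‖_{L^r} dξ'`
(with the essential-supremum modification of the inner norms when `q = ∞` or `r = ∞`,
realized via `eLpNorm`). -/
theorem smoothing_estimate_Wq (d : ℕ) (hd : 1 ≤ d) (m : ℝ) (hm : 2 ≤ m)
    (μ : EuclideanSpace ℝ (Fin d) → ℝ)
    (hsmooth : ContDiffOn ℝ (⊤ : ℕ∞) μ {x | x ≠ 0})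
    (hhom : ∀ c : ℝ, 0 < c → ∀ x : EuclideanSpace ℝ (Fin d), x ≠ 0 →
      μ (c • x) = c ^ m * μ x)
    (hhess : ∀ x : EuclideanSpace ℝ (Fin d), ‖x‖ = 1 →
      Function.Bijective ⇑(fderiv ℝ (fderiv ℝ μ) x))
    (Ftμ : ℝ → EuclideanSpace ℝ (Fin d) → ℂ)
    (hFtμ : ∀ t : ℝ, ∀ y : EuclideanSpace ℝ (Fin d), y ≠ 0 →
      Ftμ t y = Complex.exp (((2 * Real.pi * (t * μ y) : ℝ) : ℂ) * Complex.I))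
    (hFtμ0 : ∀ t : ℝ, Ftμ t 0 = 1)
    (g : SchwartzMap (EuclideanSpace ℝ (Fin d)) ℂ) (hg : g ≠ 0)
    (p p' q r : ℝ≥0∞) (hp : 1 ≤ p) (hpp' : 1 / p + 1 / p' = 1)
    (hq1 : 1 ≤ q) (hqp' : q ≤ p') (hr : 1 / p + 1 / q = 1 + 1 / r) :
    ∃ C : ℝ, 0 < C ∧ ∀ t : ℝ, 0 < t → t ≤ 1 →
      ∀ h : SchwartzMap (EuclideanSpace ℝ (Fin d)) ℂ, ∀ ξ : EuclideanSpace ℝ (Fin d),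
        eLpNorm (fun x : EuclideanSpace ℝ (Fin d) =>
            ∫ (y : EuclideanSpace ℝ (Fin d)),
              Complex.exp (-(((2 * Real.pi * ⟪ξ, y⟫ : ℝ) : ℂ) * Complex.I)) *
                (Ftμ t y * h y) * (starRingEnd ℂ) (g (y - x))) q volume ≤
        ENNReal.ofReal (C * t ^ (-(2 * (d : ℝ) / (m * p'.toReal)))) *
          ∫⁻ ξ' : EuclideanSpace ℝ (Fin d),
            eLpNorm (fun x : EuclideanSpace ℝ (Fin d) =>
              ∫ (y : EuclideanSpace ℝ (Fin d)),
                Complex.exp (-(((2 * Real.pi * ⟪ξ', y⟫ : ℝ) : ℂ) * Complex.I)) * h y *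
                  (starRingEnd ℂ) (g (y - x))) r volume ∂volume := by
  have : NeZero d := ⟨by omega⟩
  have hs : SmoothEst.Smo μ := hsmooth
  have hh : SmoothEst.Hom m μ := fun c hc x hx => hhom c hc x hx
  have hd' : Module.finrank ℝ (EuclideanSpace ℝ (Fin d)) = d := finrank_euclideanSpace_fin
  have : Nontrivial (EuclideanSpace ℝ (Fin d)) := by
    apply Module.nontrivial_of_finrank_pos (R := ℝ)
    rw [hd']; omega
  obtain ⟨C₁, hC₁, hrep⟩ := SmoothEst.rep_bound hm hs hh (d + 1) Ftμ hFtμ g hg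
  obtain ⟨C₂, hC₂, hS⟩ := SmoothEst.Sm_norm hm hs hh (fun x hx => (hhess x hx).1) p'
    (hq1.trans hqp')
  rw [hd'] at hS
  have hp0 : p⁻¹ ≠ ⊤ := by
    rw [ne_eq, ENNReal.inv_eq_top]
    rintro rfl
    simp at hp
  have hH : ENNReal.HolderTriple p' r q := by
    refine ⟨?_⟩
    simp only [one_div] at hpp' hr
    rw [← hpp', add_assoc] at hr
    exact ((ENNReal.add_right_inj hp0).1 hr).symm
  set k : EuclideanSpace ℝ (Fin d) → ℝ≥0∞ :=
    fun v => ENNReal.ofReal (SmoothEst.wt (d + 1) v)⁻¹ with hk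
  have hkm : Measurable k := by
    have : Measurable (fun v : EuclideanSpace ℝ (Fin d) => (SmoothEst.wt (d + 1) v)⁻¹) := by
      unfold SmoothEst.wt
      exact ((measurable_const.add measurable_norm).pow_const _).inv
    exact ENNReal.measurable_ofReal.comp this
  have hkf : ∫⁻ z, k z ≠ ⊤ := by
    have := finite_integral_one_add_norm (E := EuclideanSpace ℝ (Fin d)) (μ := volume)
      (r := (d + 1 : ℕ)) (by rw [hd']; push_cast; linarith)
    refine (lt_of_eq_of_lt ?_ this).ne
    congr 1
    funext z
    simp only [hk, SmoothEst.wt]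
    rw [Real.rpow_neg (by positivity), Real.rpow_natCast]
  set κ := (∫⁻ z, k z).toReal with hκ
  have hκe : ∫⁻ z, k z = ENNReal.ofReal κ := (ENNReal.ofReal_toReal hkf).symm
  have hκ0 : 0 ≤ κ := ENNReal.toReal_nonneg
  refine ⟨C₁ * (κ * κ * C₂) + 1, by positivity, fun t ht ht1 h ξ => ?_⟩
  set θ : ℝ := t ^ (-(2 * (d : ℝ) / (m * p'.toReal))) with hθ
  have hθ0 : 0 ≤ θ := by positivity
  have key := SmoothEst.assembly k hkm (SmoothEst.Gab g h) (SmoothEst.Gab_meas g h)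
    (SmoothEst.Sm (d + 1) μ m t) (SmoothEst.Sm_meas (d + 1) μ m t).stronglyMeasurable p' q r hq1
    hkf (ENNReal.ofReal (C₂ * θ)) ENNReal.ofReal_ne_top (fun ζ => hS t ζ ht ht1)
    (ENNReal.ofReal C₁) ξ _ (fun x => hrep t ht ht1 h ξ x)
  refine key.trans ?_
  rw [← mul_assoc]
  refine mul_le_mul' ?_ le_rfl
  rw [hκe, ← ENNReal.ofReal_mul hκ0, ← ENNReal.ofReal_mul (by positivity),
    ← ENNReal.ofReal_mul hC₁]
  refine ENNReal.ofReal_le_ofReal ?_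
  nlinarith
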